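/- Let d ≥ 2, let η be the uniform distribution on d outcomes, and let p, q ∈ ℝ^d be probability distributions with D(p‖η) > 0, D(q‖η) > 0, V(p‖η) > 0 and V(q‖η) > 0. Let (t_n) be a moderate sequence, and set ε_n^− = e^{−n t_n²} and ε_n^+ = 1 − e^{−n t_n²}. For ε ≥ 0 define R_n^{th}(ε) = (1/n)·sup{ m ∈ ℕ : p^{⊗n} ⊗ η^{⊗m} ≻_ε q^{⊗m} ⊗ η^{⊗n} }, where ≻_ε is approximate majorisation with total variation error. Set ν = (V(p‖η)/D(p‖η)) / (V(q‖η)/D(q‖η)). Then, for both choices of sign, lim_{n→∞} ( R_n^{th}(ε_n^±) − D(p‖η)/D(q‖η) ) / t_n = ±(√(2 V(p‖η)) / D(q‖η)) · |1 ± 1/√ν|. -/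

import Mathlib

open Finset Filter Real Topology

noncomputable section

/-- A probability distribution on a finite type: nonnegative entries summing to 1. -/
def IsProbDist {α : Type*} [Fintype α] (a : α → ℝ) : Prop :=
  (∀ i, 0 ≤ a i) ∧ ∑ i, a i = 1

/-- A sharp distribution: a single entry equal to 1, all others 0. -/
def IsSharp {α : Type*} [Fintype α] (a : α → ℝ) : Prop :=
  ∃ i, a i = 1 ∧ ∀ j, j ≠ i → a j = 0

/-- The uniform distribution: all entries equal to `1 / |α|`. -/
def IsUniform {α : Type*} [Fintype α] (a : α → ℝ) : Prop :=
  ∀ i, a i = 1 / (Fintype.card α : ℝ)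

/-- Tensor (Kronecker) product of two vectors. -/
def tensor {α β : Type*} (a : α → ℝ) (b : β → ℝ) : α × β → ℝ :=
  fun x => a x.1 * b x.2

/-- `n`-fold tensor power of a vector. -/
def tpow {α : Type*} (a : α → ℝ) (n : ℕ) : (Fin n → α) → ℝ :=
  fun f => ∏ j, a (f j)

/-- Shannon entropy (natural logarithm, with the convention `0 · ln 0 = 0`). -/
def shannonH {α : Type*} [Fintype α] (a : α → ℝ) : ℝ :=
  -∑ i, a i * Real.log (a i)

/-- Entropy variance `V(a) = ∑ i, a i (ln a i + H(a))²`. -/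
def entV {α : Type*} [Fintype α] (a : α → ℝ) : ℝ :=
  ∑ i, a i * (Real.log (a i) + shannonH a) ^ 2

/-- Relative entropy `D(a‖b)`. -/
def relD {α : Type*} [Fintype α] (a b : α → ℝ) : ℝ :=
  ∑ i, a i * Real.log (a i / b i)

/-- Relative entropy variance `V(a‖b)`. -/
def relV {α : Type*} [Fintype α] (a b : α → ℝ) : ℝ :=
  ∑ i, a i * (Real.log (a i / b i) - relD a b) ^ 2

/-- Total variation distance. -/
def tvd {α : Type*} [Fintype α] (a b : α → ℝ) : ℝ :=
  (1 / 2) * ∑ i, |a i - b i|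

/-- Fidelity `F(a,b) = (∑ i √(a i · b i))²`. -/
def fid {α : Type*} [Fintype α] (a b : α → ℝ) : ℝ :=
  (∑ i, Real.sqrt (a i * b i)) ^ 2

/-- The entries of `a` sorted in non-increasing order, as a vector on `Fin (card α)`. -/
def descSorted {α : Type*} [Fintype α] (a : α → ℝ) : Fin (Fintype.card α) → ℝ :=
  fun i =>
    a ((Fintype.equivFin α).symm
      (Tuple.sort (fun j => -a ((Fintype.equivFin α).symm j)) i))

/-- `headSum a K = ∑_{1 ≤ i ≤ K} a^↓_i` (1-based indices `i`, comparison `(i : ℝ) ≤ K`,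
equivalently `i ≤ ⌊K⌋`). -/
def headSum {α : Type*} [Fintype α] (a : α → ℝ) (K : ℝ) : ℝ :=
  ∑ i ∈ Finset.univ.filter (fun i : Fin (Fintype.card α) => ((i : ℕ) + 1 : ℝ) ≤ K),
    descSorted a i

/-- `tailSum a K = ∑_{i ≥ K} a^↓_i` (1-based indices `i`, comparison `K ≤ (i : ℝ)`,
equivalently `i ≥ ⌈K⌉`). -/
def tailSum {α : Type*} [Fintype α] (a : α → ℝ) (K : ℝ) : ℝ :=
  ∑ i ∈ Finset.univ.filter (fun i : Fin (Fintype.card α) => K ≤ ((i : ℕ) + 1 : ℝ)),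
    descSorted a i

/-- `a` majorises `b` (written `a ≻ b`): every partial sum of the non-increasingly sorted
`a` dominates the corresponding partial sum of sorted `b` (shorter vectors padded with zeros). -/
def Maj {α β : Type*} [Fintype α] [Fintype β] (a : α → ℝ) (b : β → ℝ) : Prop :=
  ∀ j : ℕ, headSum b (j : ℝ) ≤ headSum a (j : ℝ)

/-- `a ≻_ε b`: approximate majorisation (from above) with total variation error:
there is a probability distribution `b̃` with `a ≻ b̃` and `δ(b, b̃) ≤ ε`. -/
def ApproxMajTV {α β : Type*} [Fintype α] [Fintype β] (a : α → ℝ) (b : β → ℝ) (ε : ℝ) : Prop :=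
  ∃ bt : β → ℝ, IsProbDist bt ∧ Maj a bt ∧ tvd b bt ≤ ε

/-- `a ≺_ε b`: approximate majorisation (from below) with total variation error:
there is a probability distribution `b̃` with `a ≺ b̃` and `δ(b, b̃) ≤ ε`. -/
def ApproxSubMajTV {α β : Type*} [Fintype α] [Fintype β] (a : α → ℝ) (b : β → ℝ) (ε : ℝ) : Prop :=
  ∃ bt : β → ℝ, IsProbDist bt ∧ Maj bt a ∧ tvd b bt ≤ ε

/-- A moderate sequence: `t n → 0` and `√n · t n → +∞`. -/
def ModerateSeq (t : ℕ → ℝ) : Prop :=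
  Tendsto t atTop (𝓝 0) ∧ Tendsto (fun n : ℕ => Real.sqrt (n : ℝ) * t n) atTop atTop

/-- The uniform distribution on `Fin d`. -/
def unif (d : ℕ) : Fin d → ℝ := fun _ => 1 / (d : ℝ)

/-- The embedding map `Γ` associated with `γ_i = c_i / N`: for each `i` it produces
`c_i` entries equal to `a_i / c_i`. -/
def embed {d : ℕ} (c : Fin d → ℕ) (a : Fin d → ℝ) : (Σ i : Fin d, Fin (c i)) → ℝ :=
  fun x => a x.1 / (c x.1 : ℝ)

/-- Cut-and-pile modification of the sorted version of `a`, with cut at `K`: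
the first entry absorbs the total mass of entries at (1-based) positions `≥ K`,
entries at positions `1 < i < K` are unchanged, and entries at positions `≥ K` are set to 0. -/
def cutAndPile {α : Type*} [Fintype α] (a : α → ℝ) (K : ℝ) : Fin (Fintype.card α) → ℝ :=
  fun i =>
    if (i : ℕ) = 0 then descSorted a i + tailSum a K
    else if ((i : ℕ) + 1 : ℝ) < K then descSorted a i else 0

theorem descSorted_antitone {α : Type*} [Fintype α] (a : α → ℝ) : Antitone (descSorted a) := by
  intro i j hij
  have := Tuple.monotone_sort (fun j => -a ((Fintype.equivFin α).symm j)) hij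
  simpa [descSorted] using this

theorem sum_descSorted {α : Type*} [Fintype α] (a : α → ℝ) (g : ℝ → ℝ) :
    ∑ i, g (descSorted a i) = ∑ x, g (a x) :=
  Fintype.sum_equiv ((Tuple.sort fun j => -a ((Fintype.equivFin α).symm j)).trans
    (Fintype.equivFin α).symm) _ _ fun _ => rfl

theorem headSum_natCast {α : Type*} [Fintype α] (a : α → ℝ) (j : ℕ) :
    headSum a j = ∑ i ∈ univ.filter (fun i : Fin (Fintype.card α) => (i : ℕ) < j),
      descSorted a i := by
  unfold headSum
  congr 1
  ext i
  simp only [mem_filter, mem_univ, true_and]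
  exact_mod_cast Nat.succ_le_iff

theorem headSum_eq_sum {α : Type*} [Fintype α] (a : α → ℝ) {j : ℕ} (hj : Fintype.card α ≤ j) :
    headSum a j = ∑ x, a x := by
  rw [headSum_natCast, ← sum_descSorted a fun x => x, filter_true_of_mem]
  exact fun i _ => i.2.trans_le hj

theorem headSum_le_sum {α : Type*} [Fintype α] {a : α → ℝ} (ha : ∀ i, 0 ≤ a i) (j : ℕ) :
    headSum a j ≤ ∑ x, a x := by
  rw [headSum_natCast, ← sum_descSorted a fun x => x]
  exact sum_le_sum_of_subset_of_nonneg (filter_subset _ _) fun i _ _ => ha _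

/-- The sum of the positive parts of `a - c`. -/
def hinge {α : Type*} [Fintype α] (a : α → ℝ) (c : ℝ) : ℝ := ∑ i, max (a i - c) 0

theorem headSum_sub_le_hinge {α : Type*} [Fintype α] (a : α → ℝ) (j : ℕ) {c : ℝ} (hc : 0 ≤ c) :
    headSum a j - j * c ≤ hinge a c := by
  rw [headSum_natCast, hinge, ← sum_descSorted a fun x => max (x - c) 0]
  set s := univ.filter (fun i : Fin (Fintype.card α) => (i : ℕ) < j) with hs
  have hcard : (#s : ℝ) ≤ j := by
    have : s.map Fin.valEmbedding ⊆ range j := by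
      intro x
      simp only [hs, Finset.mem_map, mem_filter, mem_univ, true_and, Fin.valEmbedding_apply,
        Finset.mem_range]
      rintro ⟨i, hi, rfl⟩
      exact hi
    have := card_le_card this
    rw [card_map, card_range] at this
    exact_mod_cast this
  have h1 : ∑ i ∈ s, (descSorted a i - c) ≤ ∑ i, max (descSorted a i - c) 0 :=
    (sum_le_sum fun i _ => le_max_left _ _).trans
      (sum_le_sum_of_subset_of_nonneg (subset_univ _) fun i _ _ => le_max_right _ _)
  rw [sum_sub_distrib, sum_const, nsmul_eq_mul] at h1
  nlinarith

theorem exists_hinge_eq {α : Type*} [Fintype α] (a : α → ℝ) (c : ℝ) :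
    ∃ j : ℕ, hinge a c = headSum a j - j * c := by
  set s := univ.filter (fun i : Fin (Fintype.card α) => c < descSorted a i) with hs
  have hlt : s ⊆ univ.filter (fun i : Fin (Fintype.card α) => (i : ℕ) < #s) := by
    intro i hi
    simp only [mem_filter, mem_univ, true_and]
    have : Finset.Iic i ⊆ s := by
      intro k hk
      simp only [hs, mem_filter, mem_univ, true_and] at hi ⊢
      exact hi.trans_le (descSorted_antitone a (Finset.mem_Iic.1 hk))
    have := card_le_card this
    rw [Fin.card_Iic] at this
    omega
  have hcard : #(univ.filter (fun i : Fin (Fintype.card α) => (i : ℕ) < #s)) ≤ #s := by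
    rw [Fin.card_filter_val_lt]
    exact min_le_right _ _
  refine ⟨#s, ?_⟩
  rw [headSum_natCast, ← eq_of_subset_of_card_le hlt hcard, hinge,
    ← sum_descSorted a fun x => max (x - c) 0, ← nsmul_eq_mul, ← sum_const, ← sum_sub_distrib,
    hs, sum_filter]
  refine sum_congr rfl fun i _ => ?_
  split_ifs with h
  · exact max_eq_left (by linarith)
  · exact max_eq_right (by linarith)

theorem exists_headSum_eq {α : Type*} [Fintype α] {a : α → ℝ} (ha : ∀ i, 0 ≤ a i) {j : ℕ}
    (hj : j < Fintype.card α) : ∃ c, 0 ≤ c ∧ headSum a j = hinge a c + j * c := by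
  refine ⟨descSorted a ⟨j, hj⟩, ha _, ?_⟩
  have hcard : #(univ.filter (fun i : Fin (Fintype.card α) => (i : ℕ) < j)) = j := by
    rw [Fin.card_filter_val_lt]
    exact min_eq_right hj.le
  set c := descSorted a ⟨j, hj⟩
  have : (j : ℝ) * c = ∑ i ∈ univ.filter (fun i : Fin (Fintype.card α) => (i : ℕ) < j), c := by
    rw [sum_const, hcard, nsmul_eq_mul]
  rw [headSum_natCast, ← sub_eq_iff_eq_add, this, ← sum_sub_distrib, hinge,
    ← sum_descSorted a fun x => max (x - c) 0, sum_filter]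
  refine sum_congr rfl fun i _ => ?_
  split_ifs with h
  · exact (max_eq_left (sub_nonneg.2 (descSorted_antitone a (Fin.le_def.2 h.le)))).symm
  · exact (max_eq_right (sub_nonpos.2 (descSorted_antitone a (Fin.le_def.2 (not_lt.1 h))))).symm

/-- Majorisation between distributions is domination of all hinge sums. -/
theorem maj_iff_hinge_le {α β : Type*} [Fintype α] [Fintype β] {a : α → ℝ} {b : β → ℝ}
    (ha : IsProbDist a) (hb : IsProbDist b) :
    Maj a b ↔ ∀ c, 0 ≤ c → hinge b c ≤ hinge a c := by
  constructor
  · intro h c hc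
    obtain ⟨j, hj⟩ := exists_hinge_eq b c
    linarith [h j, headSum_sub_le_hinge a j hc]
  · intro h j
    rcases lt_or_ge j (Fintype.card α) with hj | hj
    · obtain ⟨c, hc, hac⟩ := exists_headSum_eq ha.1 hj
      linarith [h c hc, headSum_sub_le_hinge b j hc]
    · rw [headSum_eq_sum a hj, ha.2, ← hb.2]
      exact headSum_le_sum hb.1 j

theorem hinge_le_add_tvd {β : Type*} [Fintype β] {b b' : β → ℝ} (hb : ∑ i, b i = ∑ i, b' i)
    (c : ℝ) : hinge b c ≤ hinge b' c + tvd b b' := by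
  have h : ∑ i, (b i - b' i) = 0 := by rw [sum_sub_distrib, hb, sub_self]
  have h2 : tvd b b' = ∑ i, (|b i - b' i| + (b i - b' i)) / 2 := by
    rw [tvd, ← sum_div, sum_add_distrib, h]
    ring
  rw [h2, hinge, hinge, ← sum_add_distrib]
  refine sum_le_sum fun i _ => max_le ?_ ?_
  · linarith [le_max_left (b' i - c) 0, le_abs_self (b i - b' i)]
  · linarith [le_max_right (b' i - c) 0, neg_abs_le (b i - b' i)]

theorem sub_le_hinge {α : Type*} [Fintype α] (a : α → ℝ) (c : ℝ) :
    ∑ i, a i - Fintype.card α * c ≤ hinge a c := by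
  rw [hinge, ← nsmul_eq_mul, ← card_univ, ← sum_const, ← sum_sub_distrib]
  exact sum_le_sum fun i _ => le_max_left _ _

theorem hinge_nonneg {α : Type*} [Fintype α] (a : α → ℝ) (c : ℝ) : 0 ≤ hinge a c :=
  sum_nonneg fun _ _ => le_max_right _ _

/-- A distribution can be flattened by clamping its entries so as to lower all hinge sums by
`ε`, as far as permitted by the uniform distribution, at total variation cost `ε`. -/
theorem exists_flattened {β : Type*} [Fintype β] {b : β → ℝ} (hb : IsProbDist b) {ε : ℝ}
    (hε : 0 ≤ ε) : ∃ b' : β → ℝ, IsProbDist b' ∧ tvd b b' ≤ ε ∧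
      ∀ c, hinge b' c ≤ max (max (1 - Fintype.card β * c) 0) (hinge b c - ε) := by
  have hne : Nonempty β := by
    by_contra h
    rw [not_nonempty_iff] at h
    simpa using hb.2
  set N : ℝ := (Fintype.card β : ℝ) with hN
  have hNpos : 0 < N := by rw [hN]; exact_mod_cast Fintype.card_pos
  have hsum : ∀ x : ℝ, ∑ _i : β, x = N * x := fun x => by
    rw [sum_const, card_univ, nsmul_eq_mul]
  have hN1 : ∑ _i : β, 1 / N = 1 := by rw [hsum]; field_simp
  have hsym : ∑ i, max (1 / N - b i) 0 = hinge b (1 / N) := by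
    have h0 : ∑ i, (b i - 1 / N) = 0 := by rw [sum_sub_distrib, hb.2, hN1, sub_self]
    rw [eq_comm, hinge, ← sub_eq_zero, ← sum_sub_distrib]
    refine Eq.trans (sum_congr rfl fun i _ => ?_) h0
    rcases le_total (b i) (1 / N) with h | h
    · rw [max_eq_right (by linarith), max_eq_left (by linarith)]; ring
    · rw [max_eq_left (by linarith), max_eq_right (by linarith)]; ring
  rcases le_or_gt (hinge b (1 / N)) ε with h | h
  · refine ⟨fun _ => 1 / N, ⟨fun _ => by positivity, hN1⟩, ?_, fun c => le_max_of_le_left ?_⟩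
    · refine le_trans (le_of_eq ?_) h
      have : hinge b (1 / N) = (1 / 2) * (hinge b (1 / N) + ∑ i, max (1 / N - b i) 0) := by
        rw [hsym]; ring
      rw [this, tvd, hinge, ← sum_add_distrib]
      congr 1
      refine sum_congr rfl fun i _ => ?_
      rcases le_total (b i) (1 / N) with h | h
      · rw [max_eq_right (by linarith), max_eq_left (by linarith), abs_of_nonpos (by linarith)]
        ring
      · rw [max_eq_left (by linarith), max_eq_right (by linarith), abs_of_nonneg (by linarith)]
        ring
    · rw [hinge, hsum, mul_max_of_nonneg _ _ hNpos.le]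
      apply le_of_eq
      congr 1
      · field_simp
      · ring
  · have hb1 : ∀ i, b i ≤ 1 := fun i => by
      rw [← hb.2]; exact single_le_sum (f := b) (fun j _ => hb.1 j) (mem_univ i)
    obtain ⟨u, hu, huε⟩ : ∃ u ∈ Set.Icc (1 / N) 1, hinge b u = ε := by
      have hN1' : 1 / N ≤ 1 := by
        rw [div_le_one hNpos, hN]; exact_mod_cast Fintype.card_pos
      have hcont : ContinuousOn (hinge b) (Set.Icc (1 / N) 1) := by
        unfold hinge; fun_prop
      have h1 : hinge b 1 = 0 := sum_eq_zero fun i _ => max_eq_right (by linarith [hb1 i])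
      exact intermediate_value_Icc' hN1' hcont ⟨by rw [h1]; exact hε, h.le⟩
    obtain ⟨v, hv, hvε⟩ : ∃ v ∈ Set.Icc 0 (1 / N), ∑ i, max (v - b i) 0 = ε := by
      have hcont : ContinuousOn (fun v => ∑ i, max (v - b i) 0) (Set.Icc 0 (1 / N)) := by
        fun_prop
      have h1 : ∑ i, max (0 - b i) 0 = 0 :=
        sum_eq_zero fun i _ => max_eq_right (by linarith [hb.1 i])
      exact intermediate_value_Icc (by positivity) hcont ⟨by simp only [h1]; exact hε,
        by simp only [hsym]; exact h.le⟩
    have hvu : v ≤ u := hv.2.trans hu.1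
    have hpt : ∀ i, max v (min u (b i)) = b i - max (b i - u) 0 + max (v - b i) 0 := by
      intro i
      rcases le_total (b i) v with h | h
      · rw [min_eq_right (h.trans hvu), max_eq_left h, max_eq_right (by linarith),
          max_eq_left (by linarith)]; ring
      · rcases le_total (b i) u with h' | h'
        · rw [min_eq_right h', max_eq_right h, max_eq_right (by linarith),
            max_eq_right (by linarith)]; ring
        · rw [min_eq_left h', max_eq_right hvu, max_eq_left (by linarith),
            max_eq_right (by linarith)]; ring
    have hsum' : ∑ i, max v (min u (b i)) = 1 := by
      have : ∑ i, max (b i - u) 0 = ε := huε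
      simp only [hpt, sum_add_distrib, sum_sub_distrib, this, hvε, hb.2]
      ring
    refine ⟨fun i => max v (min u (b i)), ⟨fun i => le_max_of_le_left hv.1, hsum'⟩, ?_, ?_⟩
    · have : ε = 1 / 2 * (hinge b u + ∑ i, max (v - b i) 0) := by rw [huε, hvε]; ring
      rw [this, tvd, hinge, ← sum_add_distrib]
      refine mul_le_mul_of_nonneg_left (sum_le_sum fun i _ => ?_) (by norm_num)
      rw [hpt, abs_le]
      constructor <;> linarith [le_max_right (b i - u) 0, le_max_right (v - b i) 0]
    · intro c
      rcases le_total c v with hcv | hcv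
      · refine le_max_of_le_left (le_max_of_le_left (le_of_eq ?_))
        rw [← hsum', ← hsum, ← sum_sub_distrib]
        exact sum_congr rfl fun i _ => max_eq_left (sub_nonneg.2 (hcv.trans (le_max_left _ _)))
      rcases le_total c u with hcu | hcu
      · refine le_max_of_le_right (le_of_eq ?_)
        rw [← huε, hinge, hinge, hinge, ← sum_sub_distrib]
        refine sum_congr rfl fun i _ => ?_
        rcases le_total (b i) c with h | h
        · rw [max_eq_right (sub_nonpos.2 (max_le hcv ((min_le_right _ _).trans h))),
            max_eq_right (by linarith), max_eq_right (by linarith)]; ring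
        · rw [max_eq_left (sub_nonneg.2 (le_max_of_le_right (le_min hcu h))), hpt,
            max_eq_right (by linarith : v - b i ≤ 0), max_eq_left (by linarith : 0 ≤ b i - c)]
          ring
      · refine le_max_of_le_left (le_max_of_le_right (le_of_eq ?_))
        exact sum_eq_zero fun i _ => max_eq_right
          (sub_nonpos.2 ((max_le hvu (min_le_left _ _)).trans hcu))

/-- Approximate majorisation in total variation is approximate domination of hinge sums. -/
theorem approxMajTV_iff {α β : Type*} [Fintype α] [Fintype β] {a : α → ℝ} {b : β → ℝ}
    (ha : IsProbDist a) (hb : IsProbDist b) (hcard : Fintype.card α = Fintype.card β) {ε : ℝ}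
    (hε : 0 ≤ ε) : ApproxMajTV a b ε ↔ ∀ c, 0 ≤ c → hinge b c ≤ hinge a c + ε := by
  constructor
  · rintro ⟨b', hb', hmaj, htv⟩ c hc
    linarith [hinge_le_add_tvd (hb.2.trans hb'.2.symm) c, (maj_iff_hinge_le ha hb').1 hmaj c hc]
  · intro h
    obtain ⟨b', hb', htv, hh⟩ := exists_flattened hb hε
    refine ⟨b', hb', (maj_iff_hinge_le ha hb').2 fun c hc => (hh c).trans ?_, htv⟩
    have := sub_le_hinge a c
    rw [ha.2, hcard] at this
    exact max_le (max_le this (hinge_nonneg a c)) (by linarith [h c hc])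

theorem tpow_nonneg {α : Type*} {p : α → ℝ} (hp : ∀ i, 0 ≤ p i) (n : ℕ) (f : Fin n → α) :
    0 ≤ tpow p n f :=
  prod_nonneg fun _ _ => hp _

theorem sum_tpow {α : Type*} [Fintype α] (p : α → ℝ) (n : ℕ) :
    ∑ f, tpow p n f = (∑ i, p i) ^ n :=
  (Fintype.sum_pow p n).symm

theorem IsProbDist.tpow {α : Type*} [Fintype α] {p : α → ℝ} (hp : IsProbDist p) (n : ℕ) :
    IsProbDist (tpow p n) :=
  ⟨tpow_nonneg hp.1 n, by rw [sum_tpow, hp.2, one_pow]⟩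

theorem IsProbDist.tensor {α β : Type*} [Fintype α] [Fintype β] {a : α → ℝ} {b : β → ℝ}
    (ha : IsProbDist a) (hb : IsProbDist b) : IsProbDist (tensor a b) := by
  refine ⟨fun x => mul_nonneg (ha.1 _) (hb.1 _), ?_⟩
  simp only [_root_.tensor, Fintype.sum_prod_type, ← mul_sum, hb.2, mul_one, ha.2]

/-- The `p^{⊗n}`-probability that the sum of `X` over the `n` letters is at least `x`. -/
def tailMass {α : Type*} [Fintype α] (p X : α → ℝ) (n : ℕ) (x : ℝ) : ℝ :=
  ∑ f with x ≤ ∑ j, X (f j), tpow p n f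

theorem tailMass_antitone {α : Type*} [Fintype α] {p : α → ℝ} (hp : IsProbDist p) (X : α → ℝ)
    (n : ℕ) : Antitone (tailMass p X n) := fun _ _ hxy =>
  sum_le_sum_of_subset_of_nonneg
    (monotone_filter_right _ fun _ _ h => hxy.trans h)
    fun _ _ _ => tpow_nonneg hp.1 n _

theorem tailMass_nonneg {α : Type*} [Fintype α] {p : α → ℝ} (hp : IsProbDist p) (X : α → ℝ)
    (n : ℕ) (x : ℝ) : 0 ≤ tailMass p X n x :=
  sum_nonneg fun _ _ => tpow_nonneg hp.1 n _

theorem tailMass_le_one {α : Type*} [Fintype α] {p : α → ℝ} (hp : IsProbDist p) (X : α → ℝ)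
    (n : ℕ) (x : ℝ) : tailMass p X n x ≤ 1 := by
  rw [← (hp.tpow n).2]
  exact sum_le_sum_of_subset_of_nonneg (filter_subset _ _) fun f _ _ => tpow_nonneg hp.1 n f

theorem sum_tpow_mul_exp {α : Type*} [Fintype α] (p X : α → ℝ) (n : ℕ) (θ : ℝ) :
    ∑ f, tpow p n f * exp (θ * ∑ j, X (f j)) = (∑ i, p i * exp (θ * X i)) ^ n := by
  rw [Fintype.sum_pow]
  refine sum_congr rfl fun f _ => ?_
  rw [tpow, mul_sum, exp_sum, prod_mul_distrib]

/-- Near zero the moment generating function of a centred variable is Gaussian to leading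
order. -/
theorem exists_mgf_bounds {α : Type*} [Fintype α] {p X : α → ℝ} (hp : IsProbDist p)
    (hX : ∑ i, p i * X i = 0) {V : ℝ} (hV : ∑ i, p i * X i ^ 2 = V) (hVpos : 0 < V) {η : ℝ}
    (hη : 0 < η) :
    ∃ c > 0, ∀ θ : ℝ, |θ| ≤ c → exp ((1 - η) * (θ ^ 2 * V / 2)) ≤ ∑ i, p i * exp (θ * X i) ∧
      ∑ i, p i * exp (θ * X i) ≤ exp ((1 + η) * (θ ^ 2 * V / 2)) := by
  obtain ⟨B, hB1, hB⟩ : ∃ B : ℝ, 1 ≤ B ∧ ∀ i, |X i| ≤ B := by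
    refine ⟨1 + ∑ i, |X i|, by linarith [sum_nonneg fun i (_ : i ∈ univ) => abs_nonneg (X i)],
      fun i => ?_⟩
    linarith [single_le_sum (f := fun i => |X i|) (fun j _ => abs_nonneg (X j)) (mem_univ i)]
  have hB0 : 0 < B := by linarith
  have key : ∀ θ : ℝ, |θ| ≤ 1 / B →
      |∑ i, p i * exp (θ * X i) - (1 + θ ^ 2 * V / 2)| ≤ B ^ 3 * |θ| ^ 3 := by
    intro θ hθ
    have h1 : ∑ i, p i * exp (θ * X i) - (1 + θ ^ 2 * V / 2)
        = ∑ i, p i * (exp (θ * X i) - (1 + θ * X i + (θ * X i) ^ 2 / 2)) := by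
      have : ∀ i, p i * (exp (θ * X i) - (1 + θ * X i + (θ * X i) ^ 2 / 2))
          = p i * exp (θ * X i) - p i - θ * (p i * X i) - θ ^ 2 / 2 * (p i * X i ^ 2) := by
        intro i; ring
      simp only [this, sum_sub_distrib, ← mul_sum, hp.2, hX, hV]
      ring
    rw [h1]
    refine (abs_sum_le_sum_abs _ _).trans ?_
    calc ∑ i, |p i * (exp (θ * X i) - (1 + θ * X i + (θ * X i) ^ 2 / 2))|
        ≤ ∑ i, p i * (B ^ 3 * |θ| ^ 3) := by
          refine sum_le_sum fun i _ => ?_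
          rw [abs_mul, abs_of_nonneg (hp.1 i)]
          refine mul_le_mul_of_nonneg_left ?_ (hp.1 i)
          have hle : |θ * X i| ≤ B * |θ| := by
            rw [abs_mul, mul_comm]
            exact mul_le_mul_of_nonneg_right (hB i) (abs_nonneg _)
          have hle1 : B * |θ| ≤ 1 := by rwa [le_div_iff₀ hB0, mul_comm] at hθ
          have := Real.exp_bound (hle.trans hle1) (n := 3) (by norm_num)
          have e : ∑ m ∈ Finset.range 3, (θ * X i) ^ m / (m.factorial : ℝ)
              = 1 + θ * X i + (θ * X i) ^ 2 / 2 := by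
            simp [Finset.sum_range_succ, Nat.factorial]
          rw [e] at this
          refine this.trans ?_
          rw [← mul_pow]
          have h3 : |θ * X i| ^ 3 ≤ (B * |θ|) ^ 3 := pow_le_pow_left₀ (abs_nonneg _) hle 3
          have h4 : ((Nat.succ 3 : ℕ) : ℝ) / ((Nat.factorial 3 : ℕ) * (3 : ℕ) : ℝ) ≤ 1 := by
            norm_num [Nat.factorial]
          exact (mul_le_of_le_one_right (by positivity) h4).trans h3
      _ = B ^ 3 * |θ| ^ 3 := by rw [← sum_mul, hp.2, one_mul]
  set c := min (1 / B) (min 1 (min (η * V / 2 / (B ^ 3 + V ^ 2)) (1 / V))) with hc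
  have hcpos : 0 < c := by rw [hc]; positivity
  refine ⟨c, hcpos, fun θ hθ => ?_⟩
  have hk := abs_le.1 (key θ (hθ.trans (min_le_left _ _)))
  have hθ1 : |θ| ≤ 1 := hθ.trans ((min_le_right _ _).trans (min_le_left _ _))
  have hθ2 : |θ| * (B ^ 3 + V ^ 2) ≤ η * V / 2 := by
    rw [← le_div_iff₀ (by positivity)]
    exact hθ.trans ((min_le_right _ _).trans ((min_le_right _ _).trans (min_le_left _ _)))
  have hθ3 : |θ| * V ≤ 1 := by
    rw [← le_div_iff₀ (by positivity)]
    exact hθ.trans ((min_le_right _ _).trans ((min_le_right _ _).trans (min_le_right _ _)))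
  have hsq : θ ^ 2 = |θ| ^ 2 := (sq_abs θ).symm
  rw [hsq] at hk ⊢
  set r := |θ|
  have hr : 0 ≤ r := abs_nonneg θ
  have hcube : r ^ 2 * (r * (B ^ 3 + V ^ 2)) ≤ r ^ 2 * (η * V / 2) :=
    mul_le_mul_of_nonneg_left hθ2 (by positivity)
  have hrV : 0 ≤ r ^ 3 * V ^ 2 := by positivity
  constructor
  · rcases le_or_gt η 1 with h1 | h1
    · set y := (1 - η) * (r ^ 2 * V / 2) with hy
      have hy0 : 0 ≤ y := mul_nonneg (by linarith) (by positivity)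
      have hyle : y ≤ r ^ 2 * V / 2 := mul_le_of_le_one_left (by positivity) (by linarith)
      have hyle1 : y ≤ 1 := by nlinarith
      have he := Real.abs_exp_sub_one_sub_id_le (x := y) (by rw [abs_of_nonneg hy0]; exact hyle1)
      have he' := (abs_le.1 he).2
      have hy2 : y ^ 2 ≤ r ^ 3 * V ^ 2 := by
        have : y ^ 2 ≤ (r ^ 2 * V / 2) ^ 2 := pow_le_pow_left₀ hy0 hyle 2
        have h4 : r * (r ^ 3 * V ^ 2) ≤ 1 * (r ^ 3 * V ^ 2) :=
          mul_le_mul_of_nonneg_right hθ1 hrV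
        nlinarith
      nlinarith
    · have : exp ((1 - η) * (r ^ 2 * V / 2)) ≤ 1 :=
        exp_le_one_iff.2 (mul_nonpos_of_nonpos_of_nonneg (by linarith) (by positivity))
      refine this.trans ?_
      calc (1 : ℝ) = ∑ i, p i * (θ * X i + 1) := by
            simp only [mul_add, mul_one, sum_add_distrib, hp.2, mul_left_comm _ θ, ← mul_sum, hX]
            ring
        _ ≤ _ := sum_le_sum fun i _ =>
            mul_le_mul_of_nonneg_left (add_one_le_exp _) (hp.1 i)
  · refine le_trans ?_ (add_one_le_exp _)
    nlinarith

theorem tailMass_le_exp_mul {α : Type*} [Fintype α] {p : α → ℝ} (hp : IsProbDist p) (X : α → ℝ)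
    (n : ℕ) (s : ℝ) {θ : ℝ} (hθ : 0 ≤ θ) :
    tailMass p X n s ≤ exp (-(θ * s)) * (∑ i, p i * exp (θ * X i)) ^ n := by
  rw [← sum_tpow_mul_exp, mul_sum, tailMass, sum_filter]
  refine sum_le_sum fun f _ => ?_
  have h0 := tpow_nonneg hp.1 n f
  split_ifs with h
  · rw [mul_left_comm, ← exp_add]
    refine le_mul_of_one_le_right h0 (one_le_exp ?_)
    have := mul_le_mul_of_nonneg_left h hθ
    linarith
  · positivity

theorem mgf_pow_le_tailMass {α : Type*} [Fintype α] {p : α → ℝ} (hp : IsProbDist p) (X : α → ℝ)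
    (n : ℕ) (s s' : ℝ) {θ φ : ℝ} (hθ : 0 ≤ θ) (hφ : 0 ≤ φ) :
    (∑ i, p i * exp (θ * X i)) ^ n ≤ exp (θ * s') * tailMass p X n s
      + exp (-(φ * s')) * (∑ i, p i * exp ((θ + φ) * X i)) ^ n
      + exp (φ * s) * (∑ i, p i * exp ((θ - φ) * X i)) ^ n := by
  simp only [← sum_tpow_mul_exp, mul_sum, tailMass, sum_filter, ← sum_add_distrib]
  refine sum_le_sum fun f _ => ?_
  have h0 := tpow_nonneg hp.1 n f
  simp only [← mul_sum]
  set S := ∑ j, X (f j)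
  have h1 : 0 ≤ exp (-(φ * s')) * (tpow p n f * exp ((θ + φ) * S)) := by positivity
  have h2 : 0 ≤ exp (φ * s) * (tpow p n f * exp ((θ - φ) * S)) := by positivity
  have h3 : 0 ≤ exp (θ * s') * if s ≤ S then tpow p n f else 0 := by
    split_ifs <;> positivity
  rcases lt_or_ge S s with hs | hs
  · have : tpow p n f * exp (θ * S) ≤ exp (φ * s) * (tpow p n f * exp ((θ - φ) * S)) := by
      rw [mul_left_comm, ← exp_add]
      refine mul_le_mul_of_nonneg_left (exp_le_exp.2 ?_) h0
      have := mul_le_mul_of_nonneg_left hs.le hφ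
      linarith
    linarith
  rcases le_or_gt S s' with hs' | hs'
  · have : tpow p n f * exp (θ * S) ≤ exp (θ * s') * if s ≤ S then tpow p n f else 0 := by
      rw [if_pos hs, mul_comm]
      exact mul_le_mul_of_nonneg_right (exp_le_exp.2 (mul_le_mul_of_nonneg_left hs' hθ)) h0
    linarith
  · have : tpow p n f * exp (θ * S) ≤ exp (-(φ * s')) * (tpow p n f * exp ((θ + φ) * S)) := by
      rw [mul_left_comm, ← exp_add]
      refine mul_le_mul_of_nonneg_left (exp_le_exp.2 ?_) h0
      have := mul_le_mul_of_nonneg_left hs'.le hφ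
      linarith
    linarith

/-- Two-sided Gaussian bounds on the tails of sums of independent centred variables, in the
range of moderate deviations. -/
theorem exists_tailMass_bounds {α : Type*} [Fintype α] {p X : α → ℝ} (hp : IsProbDist p)
    (hX : ∑ i, p i * X i = 0) {V : ℝ} (hV : ∑ i, p i * X i ^ 2 = V) (hVpos : 0 < V) {η : ℝ}
    (hη : 0 < η) :
    ∃ c > 0, ∃ K > 0, ∀ (N : ℕ) (s : ℝ), 0 < s → s ≤ c * N → K * N ≤ s ^ 2 →
      exp (-((1 + η) * (s ^ 2 / (2 * V * N)))) ≤ tailMass p X N s ∧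
      tailMass p X N s ≤ exp (-((1 - η) * (s ^ 2 / (2 * V * N)))) := by
  obtain ⟨κ, hκ, hκ4, hκη⟩ : ∃ κ : ℝ, 0 < κ ∧ κ ≤ 1 / 4 ∧ κ ≤ η / 20 :=
    ⟨min (1 / 4) (η / 20), by positivity, min_le_left _ _, min_le_right _ _⟩
  obtain ⟨c₁, hc₁, hM₁⟩ := exists_mgf_bounds hp hX hV hVpos hη
  obtain ⟨c₂, hc₂, hM₂⟩ := exists_mgf_bounds hp hX hV hVpos (η := κ ^ 2 / 10) (by positivity)
  refine ⟨V * min c₁ (c₂ / 4), by positivity, V * (8 / κ ^ 2 + 4 / η), by positivity,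
    fun N s hs hsc hsK => ?_⟩
  have hN : (0 : ℝ) < N := by
    rcases Nat.eq_zero_or_pos N with h | h
    · subst h; simp at hsc; linarith
    · exact_mod_cast h
  set w := s ^ 2 / (N * V) with hw
  have hw2 : s ^ 2 / (2 * V * N) = w / 2 := by rw [hw]; field_simp
  rw [hw2]
  have hwK : 8 / κ ^ 2 + 4 / η ≤ w := by
    rw [hw, le_div_iff₀ (by positivity)]; linarith
  have hsc' : s / (N * V) ≤ min c₁ (c₂ / 4) := by
    rw [div_le_iff₀ (by positivity)]; linarith
  constructor
  · have hκ1 : 0 < 1 - κ := by linarith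
    set σ := s / (1 - κ) with hσ
    have hσs : s = (1 - κ) * σ := by rw [hσ]; field_simp
    have hσ0 : 0 < σ := by positivity
    set θ := σ / (N * V) with hθ
    have hθ0 : 0 < θ := by positivity
    have hθc : 2 * θ ≤ c₂ := by
      have h1 : θ ≤ 2 * (s / (N * V)) := by
        rw [hθ, ← mul_div_assoc]
        refine div_le_div_of_nonneg_right ?_ (by positivity)
        rw [hσs]; nlinarith
      linarith [hsc'.trans (min_le_right _ _)]
    set v := σ ^ 2 / (N * V) with hv
    have hv0 : 0 < v := by positivity
    have hθσ : θ * σ = v := by rw [hθ, hv]; ring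
    have hθV : N * (θ ^ 2 * V / 2) = v / 2 := by rw [hθ, hv]; field_simp
    have hwv : w = (1 - κ) ^ 2 * v := by rw [hw, hv, hσs]; ring
    have hpow : ∀ {x y : ℝ}, 0 ≤ x → x ≤ exp y → x ^ N ≤ exp (N * y) := by
      intro x y hx hxy
      rw [exp_nat_mul]
      exact pow_le_pow_left₀ hx hxy N
    have hnn : ∀ θ : ℝ, 0 ≤ ∑ i, p i * exp (θ * X i) := fun θ =>
      sum_nonneg fun i _ => mul_nonneg (hp.1 i) (exp_pos _).le
    have hl : exp ((1 - κ ^ 2 / 10) * (v / 2)) ≤ (∑ i, p i * exp (θ * X i)) ^ N := by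
      have := pow_le_pow_left₀ (exp_pos _).le
        (hM₂ θ (by rw [abs_of_pos hθ0]; linarith)).1 N
      rwa [← exp_nat_mul, mul_left_comm, hθV] at this
    have hu : ∀ a : ℝ, 0 ≤ a → a ≤ 2 →
        (∑ i, p i * exp (a * θ * X i)) ^ N ≤ exp ((1 + κ ^ 2 / 10) * (a ^ 2 * (v / 2))) := by
      intro a ha ha2
      have h1 := hpow (hnn _) (hM₂ (a * θ) (by
        rw [abs_of_nonneg (by positivity)]; nlinarith)).2
      have e : N * ((1 + κ ^ 2 / 10) * ((a * θ) ^ 2 * V / 2))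
          = (1 + κ ^ 2 / 10) * (a ^ 2 * (v / 2)) := by rw [← hθV]; ring
      rwa [e] at h1
    have hkey := mgf_pow_le_tailMass hp X N s ((1 + κ) * σ) hθ0.le
      (φ := κ * θ) (by positivity)
    have e1 : θ + κ * θ = (1 + κ) * θ := by ring
    have e2 : θ - κ * θ = (1 - κ) * θ := by ring
    have hexp2 : exp (-2 : ℝ) ≤ 1 / 4 := by
      rw [exp_neg, inv_le_comm₀ (exp_pos _) (by norm_num)]
      have := Real.quadratic_le_exp_of_nonneg (x := 2) (by norm_num)
      norm_num at this ⊢; linarith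
    have hvw : w ≤ v := by
      rw [hwv]
      exact mul_le_of_le_one_left hv0.le (pow_le_one₀ hκ1.le (by linarith))
    have hκw : 2 ≤ κ ^ 2 * v / 4 := by
      have : 8 / κ ^ 2 ≤ v := by
        have : 0 < 4 / η := by positivity
        linarith
      rw [div_le_iff₀ (by positivity)] at this
      linarith
    have b1 : exp (-(κ * θ * ((1 + κ) * σ))) * (∑ i, p i * exp ((θ + κ * θ) * X i)) ^ N
        ≤ 1 / 4 * exp ((1 - κ ^ 2 / 10) * (v / 2)) := by
      rw [e1]
      refine (mul_le_mul_of_nonneg_left (hu (1 + κ) (by linarith) (by linarith))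
        (exp_pos _).le).trans (le_trans ?_ (mul_le_mul_of_nonneg_right hexp2 (exp_pos _).le))
      rw [← exp_add, ← exp_add, exp_le_exp]
      have : κ * θ * ((1 + κ) * σ) = κ * (1 + κ) * v := by rw [← hθσ]; ring
      rw [this]
      have h5 : κ ^ 2 * v * ((1 + κ) ^ 2 + 1) ≤ κ ^ 2 * v * 5 :=
        mul_le_mul_of_nonneg_left (by clear * - hκ hκ4; nlinarith) (by positivity)
      linarith
    have b2 : exp (κ * θ * s) * (∑ i, p i * exp ((θ - κ * θ) * X i)) ^ N
        ≤ 1 / 4 * exp ((1 - κ ^ 2 / 10) * (v / 2)) := by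
      rw [e2]
      refine (mul_le_mul_of_nonneg_left (hu (1 - κ) (by linarith) (by linarith))
        (exp_pos _).le).trans (le_trans ?_ (mul_le_mul_of_nonneg_right hexp2 (exp_pos _).le))
      rw [← exp_add, ← exp_add, exp_le_exp]
      have : κ * θ * s = κ * (1 - κ) * v := by rw [← hθσ, hσs]; ring
      rw [this]
      have h5 : κ ^ 2 * v * ((1 - κ) ^ 2 + 1) ≤ κ ^ 2 * v * 5 :=
        mul_le_mul_of_nonneg_left (by clear * - hκ hκ4; nlinarith) (by positivity)
      linarith
    have e3 : θ * ((1 + κ) * σ) = (1 + κ) * v := by rw [← hθσ]; ring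
    rw [e3] at hkey
    have hhalf : exp (-1 : ℝ) ≤ 1 / 2 := by
      rw [exp_neg, inv_le_comm₀ (exp_pos _) (by norm_num)]
      have := Real.add_one_le_exp (1 : ℝ)
      norm_num at this ⊢; linarith
    have hfin : exp (-1) * exp ((1 - κ ^ 2 / 10) * (v / 2))
        ≤ exp ((1 + κ) * v) * tailMass p X N s := by
      have := mul_le_mul_of_nonneg_right hhalf (exp_pos ((1 - κ ^ 2 / 10) * (v / 2))).le
      linarith
    rw [← div_le_iff₀' (exp_pos _), ← exp_add, ← exp_sub] at hfin
    refine le_trans (exp_le_exp.2 ?_) hfin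
    have hηw : 1 ≤ η * w / 4 := by
      have h4 : 4 / η ≤ w := by
        have : 0 < 8 / κ ^ 2 := by positivity
        linarith
      rw [div_le_iff₀ hη] at h4
      linarith
    have hvw2 : v ≤ (1 + 4 * κ) * w := by
      rw [hwv, ← mul_assoc]
      refine le_mul_of_one_le_left hv0.le ?_
      clear * - hκ hκ4
      nlinarith [mul_nonneg hκ.le (sub_nonneg.2 hκ4), mul_pos hκ (mul_pos hκ hκ)]
    have hw0 : 0 < w := by positivity
    have h6 : (1 + 2 * κ + κ ^ 2 / 10) * v ≤ (1 + η / 2) * w := by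
      calc (1 + 2 * κ + κ ^ 2 / 10) * v ≤ (1 + 2 * κ + κ ^ 2 / 10) * ((1 + 4 * κ) * w) :=
            mul_le_mul_of_nonneg_left hvw2 (by positivity)
        _ = ((1 + 2 * κ + κ ^ 2 / 10) * (1 + 4 * κ)) * w := by ring
        _ ≤ (1 + η / 2) * w := by
            refine mul_le_mul_of_nonneg_right ?_ hw0.le
            clear * - hκ hκ4 hκη
            nlinarith [mul_nonneg hκ.le (sub_nonneg.2 hκ4), mul_pos hκ (mul_pos hκ hκ),
              mul_nonneg (mul_nonneg hκ.le hκ.le) (sub_nonneg.2 hκ4)]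
    linarith
  · have hθ0 : 0 ≤ s / (N * V) := by positivity
    refine (tailMass_le_exp_mul hp X N s hθ0).trans ?_
    have h1 := (hM₁ (s / (N * V)) (by
      rw [abs_of_nonneg hθ0]; exact hsc'.trans (min_le_left _ _))).2
    have h2 := pow_le_pow_left₀ (sum_nonneg fun i _ =>
      mul_nonneg (hp.1 i) (exp_pos _).le) h1 N
    refine (mul_le_mul_of_nonneg_left h2 (exp_pos _).le).trans ?_
    rw [← exp_nat_mul, ← exp_add, exp_le_exp]
    have e1 : s / (N * V) * s = w := by rw [hw]; ring
    have e2 : (N : ℝ) * ((1 + η) * ((s / (N * V)) ^ 2 * V / 2)) = (1 + η) * (w / 2) := by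
      rw [hw]; field_simp
    rw [e1, e2]
    linarith

/-- The hockey-stick divergence of `p^{⊗n}` from the uniform distribution at level `exp x`. -/
def hockey {d : ℕ} (p : Fin d → ℝ) (n : ℕ) (x : ℝ) : ℝ :=
  ∑ f, tpow p n f * max (1 - exp (x - ∑ j, log (p (f j) / unif d (f j)))) 0

theorem hockey_nonneg {d : ℕ} {p : Fin d → ℝ} (hp : IsProbDist p) (n : ℕ) (x : ℝ) :
    0 ≤ hockey p n x :=
  sum_nonneg fun f _ => mul_nonneg (tpow_nonneg hp.1 n f) (le_max_right _ _)

theorem hinge_tensor_unif {d : ℕ} (hd : 0 < d) {p : Fin d → ℝ} (hp : ∀ i, 0 ≤ p i) (n m : ℕ)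
    (x : ℝ) : hinge (tensor (tpow p n) (tpow (unif d) m)) (exp x / (d : ℝ) ^ (n + m))
      = hockey p n x := by
  have hd' : (0 : ℝ) < d := by exact_mod_cast hd
  rw [hinge, Fintype.sum_prod_type, hockey]
  refine sum_congr rfl fun f _ => ?_
  have h0 := tpow_nonneg hp n f
  have hu : ∀ g, tpow (unif d) m g = (1 / d : ℝ) ^ m := fun g => by
    simp [tpow, unif]
  simp only [tensor, hu]
  rw [sum_const, card_univ, Fintype.card_fun, Fintype.card_fin, Fintype.card_fin, nsmul_eq_mul,
    Nat.cast_pow, mul_max_of_nonneg _ _ (by positivity : (0 : ℝ) ≤ (d : ℝ) ^ m), mul_zero]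
  have e1 : (d : ℝ) ^ m * (tpow p n f * (1 / d) ^ m - exp x / (d : ℝ) ^ (n + m))
      = tpow p n f - exp x / (d : ℝ) ^ n := by
    rw [pow_add, one_div, inv_pow]; field_simp
  rw [e1]
  rcases h0.eq_or_lt with h | h
  · rw [← h, zero_mul, max_eq_right]
    rw [zero_sub, neg_nonpos]
    positivity
  · have hpos : ∀ j, 0 < p (f j) := fun j => (hp _).lt_of_ne fun hj =>
      h.ne' (prod_eq_zero (mem_univ j) hj.symm)
    have hL : exp (∑ j, log (p (f j) / unif d (f j))) = tpow p n f * (d : ℝ) ^ n := by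
      rw [exp_sum, tpow]
      have : ∀ j ∈ univ, exp (log (p (f j) / unif d (f j))) = p (f j) * d := by
        intro j _
        rw [exp_log (div_pos (hpos j) (by rw [unif]; positivity)), unif]
        field_simp
      rw [prod_congr rfl this, prod_mul_distrib, prod_const, card_univ, Fintype.card_fin]
    rw [exp_sub, hL, mul_max_of_nonneg _ _ h0, mul_zero]
    congr 1
    field_simp

theorem approxMajTV_tensor_iff {d : ℕ} (hd : 0 < d) {p q : Fin d → ℝ} (hp : IsProbDist p)
    (hq : IsProbDist q) (n m : ℕ) {ε : ℝ} (hε : 0 ≤ ε) :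
    ApproxMajTV (tensor (tpow p n) (tpow (unif d) m)) (tensor (tpow q m) (tpow (unif d) n)) ε ↔
      ∀ x, hockey q m x ≤ hockey p n x + ε := by
  have hd' : (0 : ℝ) < d := by exact_mod_cast hd
  have hu : IsProbDist (unif d) := by
    refine ⟨fun i => by rw [unif]; positivity, ?_⟩
    simp only [unif, sum_const, card_univ, Fintype.card_fin, nsmul_eq_mul]
    field_simp
  have ha := (hp.tpow n).tensor (hu.tpow m)
  have hb := (hq.tpow m).tensor (hu.tpow n)
  rw [approxMajTV_iff ha hb (by simp [mul_comm]) hε]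
  constructor
  · intro h x
    have := h (exp x / (d : ℝ) ^ (n + m)) (by positivity)
    rwa [hinge_tensor_unif hd hp.1, add_comm n m, hinge_tensor_unif hd hq.1] at this
  · intro h c hc
    rcases hc.eq_or_lt with rfl | hc
    · have h0 : ∀ {γ : Type} [Fintype γ] {a : γ → ℝ}, IsProbDist a → hinge a 0 = 1 := by
        intro γ _ a ha
        rw [← ha.2, hinge]
        exact sum_congr rfl fun i _ => by rw [sub_zero, max_eq_left (ha.1 i)]
      rw [h0 ha, h0 hb]
      linarith
    · have := h (log (c * (d : ℝ) ^ (n + m)))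
      have e : c = exp (log (c * (d : ℝ) ^ (n + m))) / (d : ℝ) ^ (n + m) := by
        rw [exp_log (by positivity)]; field_simp
      rw [← hinge_tensor_unif hd hp.1 n m, ← hinge_tensor_unif hd hq.1 m n, add_comm m n,
        ← e] at this
      exact this

/-- Discarding a letter does not increase the hockey-stick divergence. -/
theorem hockey_le_succ {d : ℕ} (hd : 0 < d) {q : Fin d → ℝ} (hq : IsProbDist q) (m : ℕ) (x : ℝ) :
    hockey q m x ≤ hockey q (m + 1) x := by
  have hd' : (0 : ℝ) < d := by exact_mod_cast hd
  have hsum : ∑ i, q i * exp (-log (q i / unif d i)) ≤ 1 := by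
    calc ∑ i, q i * exp (-log (q i / unif d i)) ≤ ∑ _i : Fin d, 1 / (d : ℝ) := by
          refine sum_le_sum fun i _ => ?_
          rcases (hq.1 i).eq_or_lt with h | h
          · rw [← h, zero_mul]; positivity
          · rw [exp_neg, exp_log (div_pos h (by rw [unif]; positivity)), unif]
            apply le_of_eq
            field_simp
      _ = 1 := by
          rw [sum_const, card_univ, Fintype.card_fin, nsmul_eq_mul]; field_simp
  rw [hockey, hockey, ← (Fin.consEquiv fun _ => Fin d).sum_comp, Fintype.sum_prod_type_right]
  refine sum_le_sum fun f _ => ?_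
  have h0 := tpow_nonneg hq.1 m f
  simp only [tpow, Fin.consEquiv_apply, Fin.prod_univ_succ, Fin.sum_univ_succ, Fin.cons_zero,
    Fin.cons_succ]
  rw [tpow] at h0
  set P := ∏ j, q (f j)
  set L := ∑ j, log (q (f j) / unif d (f j))
  have e : ∀ i, q i * P * max (1 - exp (x - (log (q i / unif d i) + L))) 0
      = P * (q i * max (1 - exp (x - (log (q i / unif d i) + L))) 0) := fun i => by ring
  simp only [e, ← mul_sum]
  refine mul_le_mul_of_nonneg_left (max_le ?_ (sum_nonneg fun i _ =>
    mul_nonneg (hq.1 i) (le_max_right _ _))) h0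
  calc 1 - exp (x - L) ≤ 1 - exp (x - L) * ∑ i, q i * exp (-log (q i / unif d i)) := by
        have := mul_le_mul_of_nonneg_left hsum (exp_pos (x - L)).le
        linarith
    _ = ∑ i, q i * (1 - exp (x - (log (q i / unif d i) + L))) := by
        simp only [mul_sub, mul_one, sum_sub_distrib, hq.2, mul_sum]
        congr 1
        refine sum_congr rfl fun i _ => ?_
        rw [mul_left_comm, ← exp_add]
        congr 2
        ring
    _ ≤ _ := sum_le_sum fun i _ => mul_le_mul_of_nonneg_left (le_max_left _ _) (hq.1 i)

theorem hockey_mono {d : ℕ} (hd : 0 < d) {q : Fin d → ℝ} (hq : IsProbDist q) (x : ℝ) :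
    Monotone fun m => hockey q m x :=
  monotone_nat_of_le_succ fun m => hockey_le_succ hd hq m x

/-- The centred log-likelihood ratio of `p` with respect to the uniform distribution. -/
def devUnif {d : ℕ} (p : Fin d → ℝ) (i : Fin d) : ℝ := log (p i / unif d i) - relD p (unif d)

theorem sum_devUnif {d : ℕ} (p : Fin d → ℝ) {n : ℕ} (f : Fin n → Fin d) :
    ∑ j, log (p (f j) / unif d (f j)) = ∑ j, devUnif p (f j) + n * relD p (unif d) := by
  simp [devUnif, sum_sub_distrib]

theorem hockey_le_tailMass {d : ℕ} {p : Fin d → ℝ} (hp : IsProbDist p) (n : ℕ) (x : ℝ) :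
    hockey p n x ≤ tailMass p (devUnif p) n (x - n * relD p (unif d)) := by
  rw [hockey, tailMass, sum_filter]
  refine sum_le_sum fun f _ => ?_
  have h0 := tpow_nonneg hp.1 n f
  rw [sum_devUnif]
  split_ifs with h
  · exact mul_le_of_le_one_right h0 (max_le (sub_le_self _ (exp_pos _).le) zero_le_one)
  · rw [max_eq_right, mul_zero]
    rw [sub_nonpos]
    exact one_le_exp (by linarith)

theorem hockey_le_one_sub_tailMass {d : ℕ} {p : Fin d → ℝ} (hp : IsProbDist p) (n : ℕ) (x : ℝ) :
    hockey p n x ≤ 1 - tailMass p (-devUnif p) n (n * relD p (unif d) - x) := by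
  have e : (1 : ℝ) = ∑ f, tpow p n f := (hp.tpow n).2.symm
  refine le_of_le_of_eq ?_ (congrArg
    (· - tailMass p (-devUnif p) n (n * relD p (unif d) - x)) e).symm
  rw [hockey, tailMass, sum_filter, ← sum_sub_distrib]
  refine sum_le_sum fun f _ => ?_
  have h0 := tpow_nonneg hp.1 n f
  rw [sum_devUnif]
  simp only [Pi.neg_apply, sum_neg_distrib]
  split_ifs with h
  · rw [max_eq_right, mul_zero, sub_self]
    rw [sub_nonpos]
    exact one_le_exp (by linarith)
  · rw [sub_zero]
    exact mul_le_of_le_one_right h0 (max_le (sub_le_self _ (exp_pos _).le) zero_le_one)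

theorem mul_tailMass_le_hockey {d : ℕ} {p : Fin d → ℝ} (hp : IsProbDist p) (n : ℕ) (x δ : ℝ) :
    (1 - exp (-δ)) * tailMass p (devUnif p) n (x + δ - n * relD p (unif d)) ≤ hockey p n x := by
  rw [hockey, tailMass, sum_filter, mul_sum]
  refine sum_le_sum fun f _ => ?_
  have h0 := tpow_nonneg hp.1 n f
  rw [sum_devUnif]
  split_ifs with h
  · rw [mul_comm]
    refine mul_le_mul_of_nonneg_left (le_max_of_le_left ?_) h0
    rw [sub_le_sub_iff_left, exp_le_exp]
    linarith
  · rw [mul_zero]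
    exact mul_nonneg h0 (le_max_right _ _)

theorem one_sub_tailMass_le_hockey {d : ℕ} {p : Fin d → ℝ} (hp : IsProbDist p) (n : ℕ)
    (x δ : ℝ) :
    1 - exp (-δ) - tailMass p (-devUnif p) n (n * relD p (unif d) - x - δ) ≤ hockey p n x := by
  have e : 1 - exp (-δ) = ∑ f, tpow p n f * (1 - exp (-δ)) := by
    rw [← sum_mul, (hp.tpow n).2, one_mul]
  rw [hockey, tailMass, sum_filter, e, ← sum_sub_distrib]
  refine sum_le_sum fun f _ => ?_
  have h0 := tpow_nonneg hp.1 n f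
  rw [sum_devUnif]
  simp only [Pi.neg_apply, sum_neg_distrib]
  split_ifs with h
  · have : 0 ≤ tpow p n f * max (1 - exp
        (x - (∑ j, devUnif p (f j) + n * relD p (unif d)))) 0 :=
      mul_nonneg h0 (le_max_right _ _)
    have := mul_nonneg h0 (exp_pos (-δ)).le
    linarith
  · rw [sub_zero]
    refine mul_le_mul_of_nonneg_left (le_max_of_le_left ?_) h0
    rw [sub_le_sub_iff_left, exp_le_exp]
    linarith

/-- The tails `T n` decay as `exp (-(u / a) ^ 2 * w n)`, locally uniformly in `u > 0` on the
exponential scale. -/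
structure HasModerateTail (T : ℕ → ℝ → ℝ) (a : ℝ) (w : ℕ → ℝ) : Prop where
  antitone : ∀ᶠ n in atTop, Antitone (T n)
  nonneg : ∀ n u, 0 ≤ T n u
  bounds : ∀ η > 0, ∀ u₀ > 0, ∀ u₁, ∀ᶠ n in atTop, ∀ u ∈ Set.Icc u₀ u₁,
    exp (-((1 + η) * (u / a) ^ 2 * w n)) ≤ T n u ∧ T n u ≤ exp (-((1 - η) * (u / a) ^ 2 * w n))

theorem eventually_mul_exp_le {w : ℕ → ℝ} (hw : Tendsto w atTop atTop) {k k' : ℝ} (h : k' < k)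
    {C : ℝ} (hC : 0 < C) : ∀ᶠ n in atTop, C * exp (-(k * w n)) ≤ exp (-(k' * w n)) := by
  filter_upwards [hw.eventually_ge_atTop (log C / (k - k'))] with n hn
  rw [div_le_iff₀ (by linarith)] at hn
  rw [← exp_log hC, ← exp_add, exp_le_exp]
  linarith

namespace HasModerateTail

variable {S T : ℕ → ℝ → ℝ} {a b : ℝ} {w : ℕ → ℝ}

theorem eventually_le (hT : HasModerateTail T a w) (hw : Tendsto w atTop atTop) (ha : 0 < a)
    {u : ℝ} (hu : a < u) {C : ℝ} (hC : 0 < C) : ∀ᶠ n in atTop, T n u ≤ C * exp (-w n) := by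
  have h1 : 1 < u / a := by rwa [one_lt_div ha]
  obtain ⟨η, hη, hη1⟩ : ∃ η > 0, 1 < (1 - η) * (u / a) ^ 2 := by
    have h2 : 1 < (u / a) ^ 2 := one_lt_pow₀ h1 two_ne_zero
    refine ⟨((u / a) ^ 2 - 1) / (2 * (u / a) ^ 2), div_pos (by linarith) (by linarith), ?_⟩
    have : (1 - ((u / a) ^ 2 - 1) / (2 * (u / a) ^ 2)) * (u / a) ^ 2 = ((u / a) ^ 2 + 1) / 2 := by
      have : (u / a) ^ 2 ≠ 0 := by linarith
      generalize (u / a) ^ 2 = y at this ⊢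
      field_simp
      ring
    rw [this]
    linarith
  filter_upwards [hT.bounds η hη u (ha.trans hu) u,
    eventually_mul_exp_le hw hη1 (C := C⁻¹) (by positivity)] with n hn hn'
  refine (hn u ⟨le_rfl, le_rfl⟩).2.trans ?_
  rw [inv_mul_le_iff₀ hC, one_mul] at hn'
  exact hn'

theorem eventually_ge (hT : HasModerateTail T a w) (hw : Tendsto w atTop atTop) (ha : 0 < a)
    {u : ℝ} (hu0 : 0 < u) (hu : u < a) {C : ℝ} (hC : 0 < C) :
    ∀ᶠ n in atTop, C * exp (-w n) ≤ T n u := by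
  have h1 : u / a < 1 := by rwa [div_lt_one ha]
  have h0 : 0 < u / a := by positivity
  obtain ⟨η, hη, hη1⟩ : ∃ η > 0, (1 + η) * (u / a) ^ 2 < 1 := by
    have h2 : (u / a) ^ 2 < 1 := pow_lt_one₀ h0.le h1 two_ne_zero
    have h3 : 0 < (u / a) ^ 2 := by positivity
    refine ⟨(1 - (u / a) ^ 2) / (2 * (u / a) ^ 2), div_pos (by linarith) (by linarith), ?_⟩
    have : (1 + (1 - (u / a) ^ 2) / (2 * (u / a) ^ 2)) * (u / a) ^ 2 = ((u / a) ^ 2 + 1) / 2 := by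
      have : (u / a) ^ 2 ≠ 0 := by linarith
      generalize (u / a) ^ 2 = y at this ⊢
      field_simp
      ring
    rw [this]
    linarith
  filter_upwards [hT.bounds η hη u hu0 u, eventually_mul_exp_le hw hη1 hC] with n hn hn'
  rw [one_mul] at hn'
  exact hn'.trans (hn u ⟨le_rfl, le_rfl⟩).1

theorem eventually_add_lt (hS : HasModerateTail S a w) (hT : HasModerateTail T b w)
    (hw : Tendsto w atTop atTop) (ha : 0 < a) (hb : 0 < b) {u v : ℝ} (hu0 : 0 < u) (hu : u < a)
    (hv : b < v) {C : ℝ} (hC : 0 < C) :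
    ∀ᶠ n in atTop, T n v + C * exp (-w n) < S n u := by
  filter_upwards [hT.eventually_le hw hb hv one_pos,
    hS.eventually_ge hw ha hu0 hu (C := C + 2) (by linarith)] with n h1 h2
  linarith [exp_pos (-w n)]

theorem eventually_forall_le (hS : HasModerateTail S a w) (hT : HasModerateTail T b w)
    (hw : Tendsto w atTop atTop) (ha : 0 < a) (hb : 0 < b) {σ : ℝ} (hσ0 : 0 < σ)
    (hσ : a - b < σ) {C : ℝ} (hC : 0 < C) :
    ∀ᶠ n in atTop, ∀ u, σ / 2 ≤ u → S n u ≤ T n (u - σ) + C * exp (-w n) := by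
  obtain ⟨κ, hκσ, hκ0, hκ1⟩ : ∃ κ : ℝ, (1 + κ) * (a - b + κ * b) < σ ∧ 0 < κ ∧ κ < 1 := by
    have h1 : Tendsto (fun κ : ℝ => (1 + κ) * (a - b + κ * b)) (𝓝[>] 0) (𝓝 (a - b)) := by
      have : ContinuousAt (fun κ : ℝ => (1 + κ) * (a - b + κ * b)) 0 := by fun_prop
      have h2 := this.tendsto
      norm_num at h2
      exact h2.mono_left nhdsWithin_le_nhds
    obtain ⟨κ, h⟩ := ((h1.eventually_lt_const hσ).and (Ioo_mem_nhdsGT (zero_lt_one' ℝ))).exists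
    exact ⟨κ, h⟩
  filter_upwards [hS.eventually_le hw ha (u := a * (1 + κ)) (by nlinarith) hC,
    hS.bounds (κ / 2) (by positivity) (σ / 2) (by positivity) (a * (1 + κ)),
    hT.bounds (κ / 2) (by positivity) ((1 - κ) * (σ / 2) * b / a)
      (div_pos (mul_pos (mul_pos (by linarith) (by positivity)) hb) ha)
      ((1 - κ) * (a * (1 + κ)) * b / a),
    hS.antitone, hT.antitone, hw.eventually_ge_atTop 0] with n h1 h2 h3 hSn hTn hwn u hu
  have hCe : 0 < C * exp (-w n) := by positivity
  rcases le_or_gt u (a * (1 + κ)) with h | h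
  · have hu0 : 0 < u := by linarith
    have hκ1' : 0 ≤ 1 - κ := by linarith
    have hmem : (1 - κ) * u * b / a ∈
        Set.Icc ((1 - κ) * (σ / 2) * b / a) ((1 - κ) * (a * (1 + κ)) * b / a) := by
      constructor <;> gcongr
    have hle : u - σ ≤ (1 - κ) * u * b / a := by
      rw [le_div_iff₀ ha]
      rcases le_or_gt (a - b + κ * b) 0 with h0 | h0
      · nlinarith [mul_pos hσ0 ha, mul_nonneg hu0.le (neg_nonneg.2 h0)]
      · nlinarith [mul_le_mul_of_nonneg_right h h0.le, mul_lt_mul_of_pos_left hκσ ha]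
    have h4 : S n u ≤ T n ((1 - κ) * u * b / a) := by
      refine (h2 u ⟨hu, h⟩).2.trans (le_trans (exp_le_exp.2 ?_) (h3 _ hmem).1)
      have e : (1 - κ) * u * b / a / b = (1 - κ) * (u / a) := by field_simp
      rw [e, mul_pow, neg_le_neg_iff, ← mul_assoc]
      refine mul_le_mul_of_nonneg_right (mul_le_mul_of_nonneg_right ?_ (sq_nonneg _)) hwn
      nlinarith [mul_nonneg hκ0.le hκ1']
    linarith [hTn hle]
  · linarith [hSn h.le, hT.nonneg n (u - σ)]

end HasModerateTail

theorem tendsto_nat_mul_atTop {t : ℕ → ℝ} (ht : ModerateSeq t) :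
    Tendsto (fun n : ℕ => (n : ℝ) * t n) atTop atTop := by
  have h := (tendsto_sqrt_atTop.comp tendsto_natCast_atTop_atTop).atTop_mul_atTop₀ ht.2
  refine h.congr fun n => ?_
  simp only [Function.comp_apply]
  rw [← mul_assoc, mul_self_sqrt n.cast_nonneg]

theorem tendsto_nat_mul_sq_atTop {t : ℕ → ℝ} (ht : ModerateSeq t) :
    Tendsto (fun n : ℕ => (n : ℝ) * t n ^ 2) atTop atTop := by
  refine (ht.2.atTop_mul_atTop₀ ht.2).congr fun n => ?_
  have := mul_self_sqrt (n.cast_nonneg (α := ℝ))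
  linear_combination (t n ^ 2) * this

theorem hasModerateTail_tailMass {α : Type*} [Fintype α] {p X : α → ℝ} (hp : IsProbDist p)
    (hX : ∑ i, p i * X i = 0) {V : ℝ} (hV : ∑ i, p i * X i ^ 2 = V) (hVpos : 0 < V)
    {t : ℕ → ℝ} (ht : ModerateSeq t) {N : ℕ → ℕ} {r : ℝ} (hr : 0 < r)
    (hN : Tendsto (fun n => (N n : ℝ) / n) atTop (𝓝 r)) :
    HasModerateTail (fun n u => tailMass p X (N n) (u * (n * t n))) (√(2 * V * r))
      (fun n => n * t n ^ 2) where
  antitone := by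
    filter_upwards [(tendsto_nat_mul_atTop ht).eventually_ge_atTop 0] with n hn u v huv
    exact tailMass_antitone hp X _ (mul_le_mul_of_nonneg_right huv hn)
  nonneg n u := tailMass_nonneg hp _ _ _
  bounds η hη u₀ hu₀ u₁ := by
    obtain ⟨c, hc, K, hK, h⟩ := exists_tailMass_bounds hp hX hV hVpos (half_pos hη)
    have hρ : Tendsto (fun n => r / ((N n : ℝ) / n)) atTop (𝓝 1) := by
      have := (tendsto_const_nhds (x := r)).div hN hr.ne'
      rwa [div_self hr.ne'] at this
    have hρ1 := (hρ.const_mul (1 + η / 2)).eventually_le_const (u := 1 + η) (by linarith)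
    have hρ2 := (hρ.const_mul (1 - η / 2)).eventually_const_le (u := 1 - η) (by linarith)
    have hs1 : ∀ᶠ n in atTop, u₁ * t n < c * ((N n : ℝ) / n) := by
      refine (ht.1.const_mul u₁).eventually_lt (hN.const_mul c) ?_
      rw [mul_zero]; positivity
    have hs2 : ∀ᶠ n : ℕ in atTop, K * ((N n : ℝ) / n) ≤ u₀ ^ 2 * (n * t n ^ 2) := by
      filter_upwards [(hN.const_mul K).eventually_le_const (lt_add_one (K * r)),
        ((tendsto_nat_mul_sq_atTop ht).const_mul_atTop (by positivity :
          0 < u₀ ^ 2)).eventually_ge_atTop (K * r + 1)] with n h1 h2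
      exact h1.trans h2
    filter_upwards [hρ1, hρ2, hs1, hs2, (tendsto_nat_mul_atTop ht).eventually_gt_atTop 0,
      eventually_gt_atTop 0, hN.eventually_const_lt hr] with n hn1 hn2 hn3 hn4 hg hn0 hNn u hu
    have hn : (0 : ℝ) < n := by exact_mod_cast hn0
    have hNpos : (0 : ℝ) < N n := by
      have := mul_pos hNn hn
      rwa [div_mul_cancel₀ _ hn.ne'] at this
    have hu0 : 0 < u := hu₀.trans_le hu.1
    have ht0 : 0 < t n := pos_of_mul_pos_right hg hn.le
    obtain ⟨b1, b2⟩ := h (N n) (u * (n * t n)) (by positivity) (by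
      have e : c * (N n : ℝ) = c * ((N n : ℝ) / n) * n := by field_simp
      have h5 : u * t n ≤ u₁ * t n := mul_le_mul_of_nonneg_right hu.2 ht0.le
      have h6 := mul_le_mul_of_nonneg_right (h5.trans hn3.le) hn.le
      rw [e]
      linarith) (by
      have e : K * (N n : ℝ) = K * ((N n : ℝ) / n) * n := by field_simp
      have h5 := mul_le_mul_of_nonneg_right hn4 hn.le
      have h6 : u₀ ^ 2 * (n * t n) ^ 2 ≤ u ^ 2 * (n * t n) ^ 2 :=
        mul_le_mul_of_nonneg_right (pow_le_pow_left₀ hu₀.le hu.1 2) (by positivity)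
      rw [e, mul_pow]
      linarith)
    have e : (u * (n * t n)) ^ 2 / (2 * V * N n)
        = r / ((N n : ℝ) / n) * ((u / √(2 * V * r)) ^ 2 * (n * t n ^ 2)) := by
      rw [div_pow, sq_sqrt (by positivity)]
      field_simp
    have h7 : 0 ≤ (u / √(2 * V * r)) ^ 2 * (n * t n ^ 2) := by positivity
    rw [e, ← mul_assoc (1 + η / 2)] at b1
    rw [e, ← mul_assoc (1 - η / 2)] at b2
    constructor
    · refine le_trans (exp_le_exp.2 ?_) b1
      rw [neg_le_neg_iff, mul_assoc (1 + η)]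
      exact mul_le_mul_of_nonneg_right hn1 h7
    · refine b2.trans (exp_le_exp.2 ?_)
      rw [neg_le_neg_iff, mul_assoc (1 - η)]
      exact mul_le_mul_of_nonneg_right hn2 h7

section Thresholds

variable {d : ℕ} {p q : Fin d → ℝ} {t : ℕ → ℝ} {m : ℕ → ℕ} {α β σ : ℝ}

theorem eventually_mul_le_of_tendsto_div {f g : ℕ → ℝ} {s k : ℝ}
    (hg : Tendsto g atTop atTop) (h : Tendsto (fun n => f n / g n) atTop (𝓝 s)) (hk : k < s) :
    ∀ᶠ n in atTop, k * g n ≤ f n := by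
  filter_upwards [h.eventually_const_lt hk, hg.eventually_gt_atTop 0] with n h1 h2
  exact ((lt_div_iff₀ h2).1 h1).le

theorem eventually_le_mul_of_tendsto_div {f g : ℕ → ℝ} {s k : ℝ}
    (hg : Tendsto g atTop atTop) (h : Tendsto (fun n => f n / g n) atTop (𝓝 s)) (hk : s < k) :
    ∀ᶠ n in atTop, f n ≤ k * g n := by
  filter_upwards [h.eventually_lt_const hk, hg.eventually_gt_atTop 0] with n h1 h2
  exact ((div_lt_iff₀ h2).1 h1).le

theorem tendsto_log_cost_div (ht : ModerateSeq t) (c : ℝ) :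
    Tendsto (fun n : ℕ => (n * t n ^ 2 + c) / (n * t n)) atTop (𝓝 0) := by
  have h2 : Tendsto (fun n : ℕ => c / (n * t n)) atTop (𝓝 0) :=
    (tendsto_nat_mul_atTop ht).const_div_atTop c
  have h := ht.1.add h2
  rw [add_zero] at h
  refine h.congr' ?_
  filter_upwards [(tendsto_nat_mul_atTop ht).eventually_gt_atTop 0] with n hn
  rw [eq_div_iff hn.ne', add_mul, div_mul_cancel₀ _ hn.ne']
  ring

/-- The exact exponential tails of both log-likelihood ratios, on the scale `n * t n`. -/
structure TailHyp (p q : Fin d → ℝ) (t : ℕ → ℝ) (m : ℕ → ℕ) (α β σ : ℝ) : Prop where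
  isProbDist_left : IsProbDist p
  isProbDist_right : IsProbDist q
  moderate : ModerateSeq t
  left_pos : 0 < α
  right_pos : 0 < β
  upper_left : HasModerateTail (fun n u => tailMass p (devUnif p) n (u * (n * t n))) α
    fun n => n * t n ^ 2
  lower_left : HasModerateTail (fun n u => tailMass p (-devUnif p) n (u * (n * t n))) α
    fun n => n * t n ^ 2
  upper_right : HasModerateTail (fun n u => tailMass q (devUnif q) (m n) (u * (n * t n))) β
    fun n => n * t n ^ 2
  lower_right : HasModerateTail (fun n u => tailMass q (-devUnif q) (m n) (u * (n * t n))) β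
    fun n => n * t n ^ 2
  gap : Tendsto (fun n : ℕ => (n * relD p (unif d) - m n * relD q (unif d)) / (n * t n)) atTop
    (𝓝 σ)

namespace TailHyp

theorem direct_mem (h : TailHyp p q t m α β σ) (hσ : |α - β| < σ) :
    ∀ᶠ n in atTop, ∀ x, hockey q (m n) x ≤ hockey p n x + exp (-(n * t n ^ 2)) := by
  obtain ⟨σ', hσ1, hσ2⟩ := exists_between hσ
  have hσ0 : 0 < σ' := (abs_nonneg _).trans_lt hσ1
  have hw := tendsto_nat_mul_sq_atTop h.moderate
  have hg := tendsto_nat_mul_atTop h.moderate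
  have hgap := h.gap.sub (tendsto_log_cost_div h.moderate (log 2))
  simp only [← sub_div, sub_zero] at hgap
  filter_upwards [eventually_mul_le_of_tendsto_div hg hgap hσ2,
    h.lower_left.eventually_forall_le h.lower_right hw h.left_pos h.right_pos hσ0
      ((le_abs_self _).trans_lt hσ1) (C := 1 / 2) (by norm_num),
    h.upper_right.eventually_forall_le h.upper_left hw h.right_pos h.left_pos hσ0
      ((le_abs_self _).trans_lt (by rwa [abs_sub_comm])) (C := 1 / 2) (by norm_num),
    hg.eventually_gt_atTop 0] with n h1 h2 h3 hgn x
  set w : ℝ := n * t n ^ 2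
  set g : ℝ := n * t n
  obtain ⟨z, hz⟩ : ∃ z, z * g = x - m n * relD q (unif d) :=
    ⟨(x - m n * relD q (unif d)) / g, div_mul_cancel₀ _ hgn.ne'⟩
  have hδ : exp (-(w + log 2)) = 1 / 2 * exp (-w) := by
    rw [neg_add, exp_add, exp_neg (log 2), exp_log two_pos]; ring
  rcases le_or_gt (σ' / 2) z with hz2 | hz2
  · have b1 := hockey_le_tailMass h.isProbDist_right (m n) x
    have b2 := mul_tailMass_le_hockey h.isProbDist_left n x (w + log 2)
    have b3 := h3 z hz2
    have b4 : tailMass p (devUnif p) n ((z - σ') * g)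
        ≤ tailMass p (devUnif p) n (x + (w + log 2) - n * relD p (unif d)) :=
      tailMass_antitone h.isProbDist_left _ _ (by linarith)
    have b5 := mul_le_mul_of_nonneg_left (tailMass_le_one h.isProbDist_left (devUnif p) n
      (x + (w + log 2) - n * relD p (unif d))) (exp_pos (-(w + log 2))).le
    rw [← hz] at b1
    rw [hδ] at b2 b5
    linarith
  · have b1 := hockey_le_one_sub_tailMass h.isProbDist_right (m n) x
    have b2 := one_sub_tailMass_le_hockey h.isProbDist_left n x (w + log 2)
    have b3 := h2 (σ' - z) (by linarith)
    have b4 : tailMass p (-devUnif p) n (n * relD p (unif d) - x - (w + log 2))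
        ≤ tailMass p (-devUnif p) n ((σ' - z) * g) :=
      tailMass_antitone h.isProbDist_left _ _ (by linarith)
    have e : m n * relD q (unif d) - x = (σ' - z - σ') * g := by linarith
    rw [e] at b1
    rw [hδ] at b2
    linarith

theorem direct_not_mem (h : TailHyp p q t m α β σ) (hσ : σ < |α - β|) :
    ∀ᶠ n in atTop, ∃ x, hockey p n x + exp (-(n * t n ^ 2)) < hockey q (m n) x := by
  have hw := tendsto_nat_mul_sq_atTop h.moderate
  have hg := tendsto_nat_mul_atTop h.moderate
  have hgap := h.gap.add (tendsto_log_cost_div h.moderate 0)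
  simp only [← add_div, add_zero] at hgap
  have hα := h.left_pos
  have hβ := h.right_pos
  rcases lt_abs.1 hσ with hσ | hσ
  · obtain ⟨v, hv1, hv2⟩ := exists_between (show β < α - σ by linarith)
    obtain ⟨u, hu1, hu2⟩ := exists_between (max_lt hα (show v + σ < α by linarith))
    filter_upwards [eventually_le_mul_of_tendsto_div hg hgap
        (show σ < u - v by linarith [le_max_right 0 (v + σ)]),
      h.lower_left.eventually_add_lt h.lower_right hw hα hβ ((le_max_left _ _).trans_lt hu1) hu2
        hv1 (C := 2) two_pos] with n h1 h2
    set w : ℝ := n * t n ^ 2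
    set g : ℝ := n * t n
    refine ⟨n * relD p (unif d) - u * g, ?_⟩
    have b1 := hockey_le_one_sub_tailMass h.isProbDist_left n (n * relD p (unif d) - u * g)
    have b2 := one_sub_tailMass_le_hockey h.isProbDist_right (m n)
      (n * relD p (unif d) - u * g) w
    have b3 : tailMass q (-devUnif q) (m n)
        (m n * relD q (unif d) - (n * relD p (unif d) - u * g) - w)
        ≤ tailMass q (-devUnif q) (m n) (v * g) :=
      tailMass_antitone h.isProbDist_right _ _ (by linarith)
    rw [sub_sub_cancel] at b1
    linarith
  · obtain ⟨v, hv1, hv2⟩ := exists_between (show α < β - σ by linarith)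
    obtain ⟨u, hu1, hu2⟩ := exists_between (max_lt hβ (show v + σ < β by linarith))
    filter_upwards [eventually_le_mul_of_tendsto_div hg hgap
        (show σ < u - v by linarith [le_max_right 0 (v + σ)]),
      h.upper_right.eventually_add_lt h.upper_left hw hβ hα ((le_max_left _ _).trans_lt hu1) hu2
        hv1 (C := 2) two_pos] with n h1 h2
    set w : ℝ := n * t n ^ 2
    set g : ℝ := n * t n
    refine ⟨m n * relD q (unif d) + u * g - w, ?_⟩
    have b1 := hockey_le_tailMass h.isProbDist_left n (m n * relD q (unif d) + u * g - w)
    have b2 := mul_tailMass_le_hockey h.isProbDist_right (m n)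
      (m n * relD q (unif d) + u * g - w) w
    have b3 : tailMass p (devUnif p) n
        (m n * relD q (unif d) + u * g - w - n * relD p (unif d))
        ≤ tailMass p (devUnif p) n (v * g) :=
      tailMass_antitone h.isProbDist_left _ _ (by linarith)
    have e : m n * relD q (unif d) + u * g - w + w - m n * relD q (unif d) = u * g := by ring
    rw [e] at b2
    have b5 := mul_le_mul_of_nonneg_left (tailMass_le_one h.isProbDist_right (devUnif q) (m n)
      (u * g)) (exp_pos (-w)).le
    have := exp_pos (-w)
    linarith

theorem converse_mem (h : TailHyp p q t m α β σ) (hσ : -(α + β) < σ) :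
    ∀ᶠ n in atTop, ∀ x, hockey q (m n) x ≤ hockey p n x + (1 - exp (-(n * t n ^ 2))) := by
  have hw := tendsto_nat_mul_sq_atTop h.moderate
  have hg := tendsto_nat_mul_atTop h.moderate
  have hgap := h.gap.sub (hg.const_div_atTop (log 2))
  simp only [← sub_div, sub_zero] at hgap
  obtain ⟨u, hu1, hu2⟩ := exists_between (max_lt h.left_pos (show -σ - β < α by linarith))
  obtain ⟨v, hv1, hv2⟩ := exists_between (max_lt h.right_pos (show -σ - u < β by
    linarith [le_max_right 0 (-σ - β)]))
  filter_upwards [eventually_mul_le_of_tendsto_div hg hgap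
      (show -u - v < σ by linarith [le_max_right 0 (-σ - u)]),
    h.upper_left.eventually_ge hw h.left_pos ((le_max_left _ _).trans_lt hu1) hu2 two_pos,
    h.lower_right.eventually_ge hw h.right_pos ((le_max_left _ _).trans_lt hv1) hv2 one_pos]
    with n h1 h2 h3 x
  set w : ℝ := n * t n ^ 2
  set g : ℝ := n * t n
  rcases le_or_gt (x + log 2 - n * relD p (unif d)) (u * g) with hx | hx
  · have b1 := (hockey_le_tailMass h.isProbDist_right (m n) x).trans
      (tailMass_le_one h.isProbDist_right _ _ _)
    have b2 := mul_tailMass_le_hockey h.isProbDist_left n x (log 2)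
    have b3 : tailMass p (devUnif p) n (u * g) ≤ _ :=
      tailMass_antitone h.isProbDist_left _ _ hx
    rw [exp_neg, exp_log two_pos] at b2
    linarith
  · have b1 := hockey_le_one_sub_tailMass h.isProbDist_right (m n) x
    have b2 : tailMass q (-devUnif q) (m n) (v * g)
        ≤ tailMass q (-devUnif q) (m n) (m n * relD q (unif d) - x) :=
      tailMass_antitone h.isProbDist_right _ _ (by linarith)
    linarith [hockey_nonneg h.isProbDist_left n x]

theorem converse_not_mem (h : TailHyp p q t m α β σ) (hσ : σ < -(α + β)) :
    ∀ᶠ n in atTop, ∃ x, hockey p n x + (1 - exp (-(n * t n ^ 2))) < hockey q (m n) x := by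
  have hw := tendsto_nat_mul_sq_atTop h.moderate
  have hg := tendsto_nat_mul_atTop h.moderate
  have hgap := h.gap.add (tendsto_log_cost_div h.moderate (log 4))
  simp only [← add_div, add_zero] at hgap
  obtain ⟨u, hu1, hu2⟩ := exists_between (show α < -σ - β by linarith)
  obtain ⟨v, hv1, hv2⟩ := exists_between (show β < -σ - u by linarith)
  filter_upwards [eventually_le_mul_of_tendsto_div hg hgap (show σ < -u - v by linarith),
    h.upper_left.eventually_le hw h.left_pos hu1 (C := 1 / 4) (by norm_num),
    h.lower_right.eventually_le hw h.right_pos hv1 (C := 1 / 4) (by norm_num)] with n h1 h2 h3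
  set w : ℝ := n * t n ^ 2
  set g : ℝ := n * t n
  refine ⟨n * relD p (unif d) + u * g, ?_⟩
  have b1 := hockey_le_tailMass h.isProbDist_left n (n * relD p (unif d) + u * g)
  have b2 := one_sub_tailMass_le_hockey h.isProbDist_right (m n)
    (n * relD p (unif d) + u * g) (w + log 4)
  have b3 : tailMass q (-devUnif q) (m n)
      (m n * relD q (unif d) - (n * relD p (unif d) + u * g) - (w + log 4))
      ≤ tailMass q (-devUnif q) (m n) (v * g) :=
    tailMass_antitone h.isProbDist_right _ _ (by linarith)
  have hδ : exp (-(w + log 4)) = 1 / 4 * exp (-w) := by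
    rw [neg_add, exp_add, exp_neg (log 4), exp_log (by norm_num)]; ring
  rw [add_sub_cancel_left] at b1
  rw [hδ] at b2
  linarith [exp_pos (-w)]

end TailHyp

end Thresholds

theorem sum_mul_devUnif {d : ℕ} {p : Fin d → ℝ} (hp : IsProbDist p) :
    ∑ i, p i * devUnif p i = 0 := by
  simp [devUnif, mul_sub, sum_sub_distrib, ← sum_mul, hp.2, relD]

theorem sum_mul_neg_devUnif {d : ℕ} {p : Fin d → ℝ} (hp : IsProbDist p) :
    ∑ i, p i * (-devUnif p) i = 0 := by
  simp [sum_mul_devUnif hp]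

theorem sum_mul_neg_devUnif_sq {d : ℕ} (p : Fin d → ℝ) :
    ∑ i, p i * (-devUnif p) i ^ 2 = relV p (unif d) := by
  simp only [Pi.neg_apply, neg_sq]
  rfl

section Rate

variable {d : ℕ} {p q : Fin d → ℝ} {t : ℕ → ℝ}

/-- The number of copies of `q` for which the entropy budget left over from `n` copies of `p` is
`σ * (n * t n)`, up to rounding. -/
def copies (p q : Fin d → ℝ) (t : ℕ → ℝ) (σ : ℝ) (n : ℕ) : ℕ :=
  ⌈(n * relD p (unif d) - σ * (n * t n)) / relD q (unif d)⌉₊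

theorem tendsto_copies_gap (hDp : 0 < relD p (unif d)) (hDq : 0 < relD q (unif d))
    (ht : ModerateSeq t) (σ : ℝ) :
    Tendsto (fun n : ℕ => (n * relD p (unif d) - copies p q t σ n * relD q (unif d)) / (n * t n))
      atTop (𝓝 σ) := by
  have hg := tendsto_nat_mul_atTop ht
  have hlow : Tendsto (fun n : ℕ => σ - relD q (unif d) / (n * t n)) atTop (𝓝 σ) := by
    simpa using (hg.const_div_atTop (relD q (unif d))).const_sub σ
  have hpos : ∀ᶠ n : ℕ in atTop, σ * t n < relD p (unif d) := by
    refine (ht.1.const_mul σ).eventually_lt_const ?_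
    rwa [mul_zero]
  refine tendsto_of_tendsto_of_tendsto_of_le_of_le' hlow tendsto_const_nhds ?_ ?_
  · filter_upwards [hg.eventually_gt_atTop 0, hpos] with n hn h
    have h0 : 0 ≤ (n * relD p (unif d) - σ * (n * t n)) / relD q (unif d) := by
      refine div_nonneg ?_ hDq.le
      have := mul_le_mul_of_nonneg_left h.le (n.cast_nonneg (α := ℝ))
      linarith
    have h1 := Nat.ceil_lt_add_one h0
    rw [div_add_one hDq.ne', lt_div_iff₀ hDq] at h1
    rw [le_div_iff₀ hn, sub_mul, div_mul_cancel₀ _ hn.ne']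
    unfold copies
    linarith
  · filter_upwards [hg.eventually_gt_atTop 0] with n hn
    have h1 := Nat.le_ceil ((n * relD p (unif d) - σ * (n * t n)) / relD q (unif d))
    rw [div_le_iff₀ hDq] at h1
    rw [div_le_iff₀ hn]
    unfold copies
    linarith

theorem tendsto_copies_div (hDp : 0 < relD p (unif d)) (hDq : 0 < relD q (unif d))
    (ht : ModerateSeq t) (σ : ℝ) :
    Tendsto (fun n : ℕ => (copies p q t σ n : ℝ) / n) atTop
      (𝓝 (relD p (unif d) / relD q (unif d))) := by
  have h := (((tendsto_copies_gap hDp hDq ht σ).mul ht.1).const_sub (relD p (unif d))).div_const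
    (relD q (unif d))
  rw [mul_zero, sub_zero] at h
  refine h.congr' ?_
  filter_upwards [(tendsto_nat_mul_atTop ht).eventually_gt_atTop 0] with n hn
  have hn0 : (n : ℝ) ≠ 0 := left_ne_zero_of_mul hn.ne'
  have ht0 : t n ≠ 0 := right_ne_zero_of_mul hn.ne'
  field_simp
  ring

theorem tailHyp_copies (hp : IsProbDist p) (hq : IsProbDist q)
    (hDp : 0 < relD p (unif d)) (hDq : 0 < relD q (unif d))
    (hVp : 0 < relV p (unif d)) (hVq : 0 < relV q (unif d)) (ht : ModerateSeq t) (σ : ℝ) :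
    TailHyp p q t (copies p q t σ) √(2 * relV p (unif d))
      √(2 * relV q (unif d) * (relD p (unif d) / relD q (unif d))) σ := by
  have hr : 0 < relD p (unif d) / relD q (unif d) := div_pos hDp hDq
  have hN := tendsto_copies_div hDp hDq ht σ
  have hid : Tendsto (fun n : ℕ => (n : ℝ) / n) atTop (𝓝 1) :=
    tendsto_const_nhds.congr' (by
      filter_upwards [eventually_ne_atTop 0] with n hn
      rw [div_self (Nat.cast_ne_zero.2 hn)])
  refine ⟨hp, hq, ht, by positivity, by positivity, ?_, ?_,
    hasModerateTail_tailMass hq (sum_mul_devUnif hq) rfl hVq ht hr hN,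
    hasModerateTail_tailMass hq (sum_mul_neg_devUnif hq) (sum_mul_neg_devUnif_sq q) hVq ht hr hN,
    tendsto_copies_gap hDp hDq ht σ⟩
  · rw [← mul_one (2 * relV p (unif d))]
    exact hasModerateTail_tailMass hp (sum_mul_devUnif hp) rfl hVp ht one_pos hid
  · rw [← mul_one (2 * relV p (unif d))]
    exact hasModerateTail_tailMass hp (sum_mul_neg_devUnif hp) (sum_mul_neg_devUnif_sq p) hVp ht
      one_pos hid

theorem tendsto_rate (hd : 0 < d) (hp : IsProbDist p) (hq : IsProbDist q)
    (hDp : 0 < relD p (unif d)) (hDq : 0 < relD q (unif d)) (ht : ModerateSeq t)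
    {ε L : ℕ → ℝ} (hε : ∀ n, 0 ≤ ε n)
    (hL : ∀ n, L n = (↑(sSup {m : ℕ | ApproxMajTV (tensor (tpow p n) (tpow (unif d) m))
      (tensor (tpow q m) (tpow (unif d) n)) (ε n)}) : ℝ) / (n : ℝ))
    {s : ℝ}
    (hmem : ∀ σ, s < σ → ∀ᶠ n in atTop, ∀ x,
      hockey q (copies p q t σ n) x ≤ hockey p n x + ε n)
    (hnot : ∀ σ < s, ∀ᶠ n in atTop, ∃ x,
      hockey p n x + ε n < hockey q (copies p q t σ n) x) :
    Tendsto (fun n => (L n - relD p (unif d) / relD q (unif d)) / t n) atTop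
      (𝓝 (-s / relD q (unif d))) := by
  have hg := tendsto_nat_mul_atTop ht
  have hlim (σ : ℝ) : Tendsto (fun n : ℕ => ((copies p q t σ n : ℝ) / n
      - relD p (unif d) / relD q (unif d)) / t n) atTop (𝓝 (-σ / relD q (unif d))) := by
    refine (((tendsto_copies_gap hDp hDq ht σ).neg).div_const (relD q (unif d))).congr' ?_
    filter_upwards [hg.eventually_gt_atTop 0] with n hn
    have hn0 : (n : ℝ) ≠ 0 := left_ne_zero_of_mul hn.ne'
    have ht0 : t n ≠ 0 := right_ne_zero_of_mul hn.ne'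
    field_simp
    ring
  have hmono {a b : ℝ} {n : ℕ} (hn : 0 < n * t n) (hab : a ≤ b) :
      (a / n - relD p (unif d) / relD q (unif d)) / t n
        ≤ (b / n - relD p (unif d) / relD q (unif d)) / t n := by
    have ht0 : 0 < t n := pos_of_mul_pos_right hn n.cast_nonneg
    gcongr
  have hub (σ : ℝ) (hσ : σ < s) : ∀ᶠ n in atTop, copies p q t σ n ∈ upperBounds
      {m : ℕ | ApproxMajTV (tensor (tpow p n) (tpow (unif d) m))
        (tensor (tpow q m) (tpow (unif d) n)) (ε n)} := by
    filter_upwards [hnot σ hσ] with n ⟨x, hx⟩ m hm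
    by_contra! hlt
    have h1 := (approxMajTV_tensor_iff hd hp hq n m (hε n)).1 hm x
    have h2 := hockey_mono hd hq x hlt.le
    exact absurd (h2.trans h1) hx.not_ge
  refine tendsto_order.2 ⟨fun a ha => ?_, fun a ha => ?_⟩
  · rw [lt_div_iff₀ hDq] at ha
    obtain ⟨σ, hσ1, hσ2⟩ := exists_between (show s < -(a * relD q (unif d)) by linarith)
    filter_upwards [hmem σ hσ1, hub (s - 1) (by linarith), hg.eventually_gt_atTop 0,
      (hlim σ).eventually_const_lt ((lt_div_iff₀ hDq).2
        (by linarith : a * relD q (unif d) < -σ))] with n h1 h2 h3 h4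
    refine h4.trans_le ?_
    rw [hL n]
    exact hmono h3 (Nat.cast_le.2
      (le_csSup ⟨_, h2⟩ ((approxMajTV_tensor_iff hd hp hq n _ (hε n)).2 h1)))
  · rw [gt_iff_lt, div_lt_iff₀ hDq] at ha
    obtain ⟨σ, hσ1, hσ2⟩ := exists_between (show -(a * relD q (unif d)) < s by linarith)
    filter_upwards [hub σ hσ2, hg.eventually_gt_atTop 0,
      (hlim σ).eventually_lt_const ((div_lt_iff₀ hDq).2
        (by linarith : -σ < a * relD q (unif d)))] with n h2 h3 h4
    refine lt_of_le_of_lt ?_ h4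
    rw [hL n]
    exact hmono h3 (Nat.cast_le.2 (csSup_le' h2))

end Rate

theorem sqrt_mul_one_div_sqrt_ratio {Dp Dq Vp Vq : ℝ} (hDp : 0 < Dp) (hDq : 0 < Dq) (hVp : 0 < Vp)
    (hVq : 0 < Vq) : √(2 * Vp) * (1 / √((Vp / Dp) / (Vq / Dq))) = √(2 * Vq * (Dp / Dq)) := by
  rw [← mul_div_assoc, mul_one, ← sqrt_div (by positivity)]
  congr 1
  field_simp

/-- Moderate deviation expansion of the optimal thermodynamic-direction conversion rate
at infinite temperature (uniform free state), for both the direct and converse regimes. -/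
theorem thermo_uniform_direct_and_converse
    {d : ℕ} (hd : 2 ≤ d) (p q : Fin d → ℝ) (hp : IsProbDist p) (hq : IsProbDist q)
    (hDp : 0 < relD p (unif d)) (hDq : 0 < relD q (unif d))
    (hVp : 0 < relV p (unif d)) (hVq : 0 < relV q (unif d))
    (t : ℕ → ℝ) (ht : ModerateSeq t)
    (R : ℕ → ℝ → ℝ)
    (hR : ∀ n : ℕ, ∀ e : ℝ, 0 ≤ e → R n e =
      (↑(sSup {m : ℕ | ApproxMajTV (tensor (tpow p n) (tpow (unif d) m))
          (tensor (tpow q m) (tpow (unif d) n)) e}) : ℝ) / (n : ℝ))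
    (ν : ℝ)
    (hν : ν = (relV p (unif d) / relD p (unif d)) / (relV q (unif d) / relD q (unif d))) :
    Tendsto (fun n : ℕ =>
        (R n (Real.exp (-((n : ℝ) * t n ^ 2))) - relD p (unif d) / relD q (unif d)) / t n)
      atTop
      (𝓝 (-(Real.sqrt (2 * relV p (unif d)) / relD q (unif d)) * |1 - 1 / Real.sqrt ν|)) ∧
    Tendsto (fun n : ℕ =>
        (R n (1 - Real.exp (-((n : ℝ) * t n ^ 2))) - relD p (unif d) / relD q (unif d)) / t n)
      atTop
      (𝓝 (Real.sqrt (2 * relV p (unif d)) / relD q (unif d) * |1 + 1 / Real.sqrt ν|)) := by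
  have hd0 : 0 < d := by omega
  have key := sqrt_mul_one_div_sqrt_ratio hDp hDq hVp hVq
  rw [← hν] at key
  have H := tailHyp_copies hp hq hDp hDq hVp hVq ht
  have hα : 0 ≤ √(2 * relV p (unif d)) := sqrt_nonneg _
  constructor
  · convert tendsto_rate hd0 hp hq hDp hDq ht
      (ε := fun n => exp (-(n * t n ^ 2))) (fun n => (exp_pos _).le)
      (fun n => hR n _ (exp_pos _).le) (fun σ hσ => (H σ).direct_mem hσ)
      (fun σ hσ => (H σ).direct_not_mem hσ) using 2
    have e : √(2 * relV p (unif d)) - √(2 * relV p (unif d)) * (1 / √ν)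
        = √(2 * relV p (unif d)) * (1 - 1 / √ν) := by ring
    rw [← key, e, abs_mul, abs_of_nonneg hα]
    ring
  · have hε (n : ℕ) : 0 ≤ 1 - exp (-(n * t n ^ 2)) :=
      sub_nonneg.2 (exp_le_one_iff.2 (neg_nonpos.2 (by positivity)))
    convert tendsto_rate hd0 hp hq hDp hDq ht hε (fun n => hR n _ (hε n))
      (fun σ hσ => (H σ).converse_mem hσ) (fun σ hσ => (H σ).converse_not_mem hσ) using 2
    rw [← key, abs_of_nonneg (by positivity)]
    ring
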